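/- (Choi–Elliott–Yui) Suppose α ∈ ℝ is Liouville. Then for every λ > 0 and every ω ∈ ℝ, the spectrum of the almost Mathieu operator H^{λ,α}_ω is a Cantor set: it is closed, has no isolated points, and has empty interior in ℝ. -/

import Mathlib

/-- An irrational `α` is Liouville if there is a sequence of rationals `p_k/q_k` with
`q_k → ∞` and `|α − p_k/q_k| < k^{−q_k}` for every `k ≥ 1`. -/
def IsLiouvilleFrequency (α : ℝ) : Prop :=
  Irrational α ∧
  ∃ p : ℕ → ℤ, ∃ q : ℕ → ℕ, (∀ k, 0 < q k) ∧ Filter.Tendsto q Filter.atTop Filter.atTop ∧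
    ∀ k : ℕ, 0 < k → |α - (p k : ℝ) / (q k : ℝ)| < 1 / (k : ℝ) ^ q k

namespace AlmostMathieu

open Polynomial Matrix

section Transfer

variable {R : Type*} [CommRing R]

/-- The transfer matrix of the monic three-term recursion `g (k + 2) = E g (k + 1) - b g k`. -/
def transfer (E b : R) : Matrix (Fin 2) (Fin 2) R := !![E, -b; 1, 0]

/-- The product of the first `n` transfer matrices with coefficients `b 0, …, b (n - 1)`. -/
def cocycle (E : R) (b : ℕ → R) : ℕ → Matrix (Fin 2) (Fin 2) R
  | 0 => 1
  | n + 1 => transfer E (b n) * cocycle E b n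

/-- The continuant of `n` consecutive sites, with edge weights `b 1, …, b (n - 1)`. -/
def continuant (E : R) (b : ℕ → R) (n : ℕ) : R := cocycle E b n 0 0

lemma cocycle_zero (E : R) (b : ℕ → R) : cocycle E b 0 = 1 := rfl

lemma cocycle_succ (E : R) (b : ℕ → R) (n : ℕ) :
    cocycle E b (n + 1) = transfer E (b n) * cocycle E b n := rfl

lemma cocycle_map {S : Type*} [CommRing S] (f : R →+* S) (E : R) (b : ℕ → R) (n : ℕ) :
    (cocycle E b n).map f = cocycle (f E) (fun k => f (b k)) n := by
  induction n with
  | zero => simp [cocycle_zero]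
  | succ n ih =>
    rw [cocycle_succ, cocycle_succ, Matrix.map_mul, ih]
    congr 1
    ext i j
    fin_cases i <;> fin_cases j <;> simp [transfer]

lemma cocycle_add (E : R) (b : ℕ → R) (m n : ℕ) :
    cocycle E b (m + n) = cocycle E (fun k => b (k + n)) m * cocycle E b n := by
  induction m with
  | zero => simp [cocycle_zero]
  | succ m ih => rw [add_right_comm, cocycle_succ, cocycle_succ, ih, Matrix.mul_assoc]

lemma cocycle_succ' (E : R) (b : ℕ → R) (n : ℕ) :
    cocycle E b (n + 1) = cocycle E (fun k => b (k + 1)) n * transfer E (b 0) := by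
  rw [cocycle_add, cocycle_succ, cocycle_zero, Matrix.mul_one]

lemma det_cocycle (E : R) (b : ℕ → R) (n : ℕ) :
    (cocycle E b n).det = ∏ k ∈ Finset.range n, b k := by
  induction n with
  | zero => simp [cocycle_zero]
  | succ n ih =>
    rw [cocycle_succ, Matrix.det_mul, ih, Finset.prod_range_succ, mul_comm]
    simp [transfer, Matrix.det_fin_two]

lemma continuant_zero (E : R) (b : ℕ → R) : continuant E b 0 = 1 := by
  simp [continuant, cocycle_zero]

lemma continuant_one (E : R) (b : ℕ → R) : continuant E b 1 = E := by
  simp [continuant, cocycle_zero, cocycle_succ, transfer]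

lemma cocycle_one_zero (E : R) (b : ℕ → R) (n : ℕ) :
    cocycle E b (n + 1) 1 0 = continuant E b n := by
  simp [continuant, cocycle_succ, transfer, Matrix.mul_apply, Fin.sum_univ_two]

lemma continuant_add_two (E : R) (b : ℕ → R) (n : ℕ) :
    continuant E b (n + 2) = E * continuant E b (n + 1) - b (n + 1) * continuant E b n := by
  rw [continuant, cocycle_succ, Matrix.mul_apply, Fin.sum_univ_two, cocycle_one_zero]
  simp [continuant, transfer, sub_eq_add_neg]

lemma cocycle_zero_one (E : R) (b : ℕ → R) (n : ℕ) :
    cocycle E b (n + 1) 0 1 = -b 0 * continuant E (fun k => b (k + 1)) n := by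
  rw [cocycle_succ', Matrix.mul_apply, Fin.sum_univ_two]
  simp [continuant, transfer, mul_comm]

lemma cocycle_one_one (E : R) (b : ℕ → R) (n : ℕ) :
    cocycle E b (n + 2) 1 1 = -b 0 * continuant E (fun k => b (k + 1)) n := by
  rw [cocycle_succ, Matrix.mul_apply, Fin.sum_univ_two, cocycle_zero_one]
  simp [transfer]

lemma trace_cocycle (E : R) (b : ℕ → R) (n : ℕ) :
    (cocycle E b (n + 2)).trace =
      continuant E b (n + 2) - b 0 * continuant E (fun k => b (k + 1)) n := by
  rw [Matrix.trace_fin_two, cocycle_one_one, neg_mul, ← sub_eq_add_neg, ← continuant]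

lemma continuant_map {S : Type*} [CommRing S] (f : R →+* S) (E : R) (b : ℕ → R) (n : ℕ) :
    f (continuant E b n) = continuant (f E) (fun k => f (b k)) n := by
  rw [continuant, continuant, ← cocycle_map, Matrix.map_apply]

lemma trace_cocycle_map {S : Type*} [CommRing S] (f : R →+* S) (E : R) (b : ℕ → R) (n : ℕ) :
    f (cocycle E b n).trace = (cocycle (f E) (fun k => f (b k)) n).trace := by
  rw [← cocycle_map, Matrix.trace_fin_two, Matrix.trace_fin_two]
  simp

lemma trace_cocycle_shift (E : R) (b : ℕ → R) (q : ℕ) (hb : ∀ k, b (k + q) = b k) (j : ℕ) :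
    (cocycle E (fun k => b (k + j)) q).trace = (cocycle E b q).trace := by
  induction j with
  | zero => rfl
  | succ j ih =>
    rw [← ih]
    cases q with
    | zero => rfl
    | succ q =>
      rw [cocycle_succ' E (fun k => b (k + j)), cocycle_succ, Matrix.trace_mul_comm]
      have h1 : b (q + (j + 1)) = b (0 + j) := by rw [← hb (0 + j)]; congr 1; ring
      have h2 : (fun k => b (k + (j + 1))) = fun k => b (k + 1 + j) := by
        funext k; congr 1; ring
      rw [h1, h2]

lemma cocycle_two_mul (E : R) (b : ℕ → R) (q : ℕ) (hb : ∀ k, b (k + q) = b k) :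
    cocycle E b (q + q) = (cocycle E b q).trace • cocycle E b q -
      (∏ k ∈ Finset.range q, b k) • (1 : Matrix (Fin 2) (Fin 2) R) := by
  rw [cocycle_add, funext hb, ← det_cocycle E b q]
  set M := cocycle E b q
  ext i j
  fin_cases i <;> fin_cases j <;>
    simp [Matrix.mul_apply, Fin.sum_univ_two, Matrix.trace_fin_two, Matrix.det_fin_two] <;> ring

lemma map_derivative_cocycle (b : ℕ → R) (n : ℕ) :
    (cocycle (X : R[X]) (fun k => C (b k)) n).map derivative =
      ∑ s ∈ Finset.range n, cocycle (X : R[X]) (fun k => C (b (k + (s + 1)))) (n - 1 - s) *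
        !![1, 0; 0, 0] * cocycle (X : R[X]) (fun k => C (b k)) s := by
  induction n with
  | zero =>
    ext i j : 1
    fin_cases i <;> fin_cases j <;> simp [cocycle_zero]
  | succ n ih =>
    have h : (cocycle (X : R[X]) (fun k => C (b k)) (n + 1)).map derivative =
        transfer X (C (b n)) * (cocycle (X : R[X]) (fun k => C (b k)) n).map derivative +
          !![1, 0; 0, 0] * cocycle (X : R[X]) (fun k => C (b k)) n := by
      rw [cocycle_succ]
      ext i j : 1
      fin_cases i <;> fin_cases j <;>
        simp [transfer, Matrix.vecMul, dotProduct, Fin.sum_univ_two] <;> ring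
    rw [h, ih, Finset.sum_range_succ, Matrix.mul_sum]
    refine congrArg₂ (· + ·) ?_ ?_
    · refine Finset.sum_congr rfl fun s hs => ?_
      have hs' := Finset.mem_range.1 hs
      have h1 := cocycle_succ (X : R[X]) (fun k => C (b (k + (s + 1)))) (n - 1 - s)
      rw [show n - 1 - s + (s + 1) = n by omega, show n - 1 - s + 1 = n + 1 - 1 - s by omega] at h1
      rw [h1, ← Matrix.mul_assoc, ← Matrix.mul_assoc]
    · simp [cocycle_zero]

/-- The derivative of the discriminant is the sum of the principal minors of corank one. -/
lemma derivative_trace_cocycle (b : ℕ → R) (q : ℕ) (hb : ∀ k, b (k + q) = b k) :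
    derivative (cocycle (X : R[X]) (fun k => C (b k)) q).trace =
      ∑ s ∈ Finset.range q, continuant (X : R[X]) (fun k => C (b (k + (s + 1)))) (q - 1) := by
  have h : derivative (cocycle (X : R[X]) (fun k => C (b k)) q).trace =
      ((cocycle (X : R[X]) (fun k => C (b k)) q).map derivative).trace := by
    simp [Matrix.trace_fin_two]
  rw [h, map_derivative_cocycle, Matrix.trace_sum]
  refine Finset.sum_congr rfl fun s hs => ?_
  have hs' := Finset.mem_range.1 hs
  have h1 := cocycle_add (X : R[X]) (fun k => C (b (k + (s + 1)))) s (q - 1 - s)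
  rw [show s + (q - 1 - s) = q - 1 by omega] at h1
  have h2 : (fun k => (C (b (k + (q - 1 - s) + (s + 1))) : R[X])) = fun k => C (b k) := by
    funext k
    rw [show k + (q - 1 - s) + (s + 1) = k + q by omega, hb]
  rw [h2] at h1
  rw [continuant, h1, Matrix.trace_mul_comm, Matrix.trace_fin_two]
  simp [Matrix.mul_apply, Fin.sum_univ_two]

end Transfer

section Laurent

/-- `f` agrees on `ℂ \ {0}` with a Laurent polynomial supported in degrees `-d, …, d`. -/
def LaurentBounded (d : ℕ) (f : ℂ → ℂ) : Prop :=
  ∃ p : ℂ[X], p.natDegree ≤ 2 * d ∧ ∀ y ≠ 0, f y * y ^ d = p.eval y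

namespace LaurentBounded

variable {d e q : ℕ} {f g : ℂ → ℂ} {ζ : ℂ}

lemma const (c : ℂ) : LaurentBounded 0 fun _ => c := ⟨C c, by simp, by simp⟩

lemma mono (hf : LaurentBounded d f) (h : d ≤ e) : LaurentBounded e f := by
  obtain ⟨p, hp, hpf⟩ := hf
  refine ⟨p * X ^ (e - d), ?_, fun y hy => ?_⟩
  · refine natDegree_mul_le.trans ?_
    rw [natDegree_X_pow]
    omega
  · rw [eval_mul, eval_pow, eval_X, ← hpf y hy, mul_assoc, ← pow_add, Nat.add_sub_cancel' h]

lemma sub (hf : LaurentBounded d f) (hg : LaurentBounded d g) :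
    LaurentBounded d fun y => f y - g y := by
  obtain ⟨p, hp, hpf⟩ := hf
  obtain ⟨r, hr, hrg⟩ := hg
  refine ⟨p - r, (natDegree_sub_le _ _).trans (max_le hp hr), fun y hy => ?_⟩
  rw [eval_sub, ← hpf y hy, ← hrg y hy, sub_mul]

lemma mul (hf : LaurentBounded d f) (hg : LaurentBounded e g) :
    LaurentBounded (d + e) fun y => f y * g y := by
  obtain ⟨p, hp, hpf⟩ := hf
  obtain ⟨r, hr, hrg⟩ := hg
  refine ⟨p * r, natDegree_mul_le.trans (by omega), fun y hy => ?_⟩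
  rw [eval_mul, ← hpf y hy, ← hrg y hy]
  ring

lemma comp_mul (hf : LaurentBounded d f) (hζ : ζ ≠ 0) : LaurentBounded d fun y => f (ζ * y) := by
  obtain ⟨p, hp, hpf⟩ := hf
  refine ⟨C (ζ ^ d)⁻¹ * p.comp (C ζ * X), ?_, fun y hy => ?_⟩
  · refine (natDegree_C_mul_le _ _).trans (natDegree_comp_le.trans ?_)
    calc p.natDegree * (C ζ * X).natDegree ≤ p.natDegree * 1 :=
          Nat.mul_le_mul_left _ (by compute_degree)
      _ ≤ 2 * d := by omega
  · have := hpf (ζ * y) (mul_ne_zero hζ hy)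
    simp only [eval_mul, eval_C, eval_comp, eval_X]
    rw [← this]
    field_simp
    ring

/-- A Laurent polynomial of low degree invariant under a primitive rotation is constant. -/
lemma eq_of_invariant (hf : LaurentBounded d f) (hζ : IsPrimitiveRoot ζ q) (hq : 0 < q)
    (hd : 2 * d ≤ q) (hinv : ∀ y ≠ 0, f (ζ * y) = f y) {y : ℂ} (hy : y ≠ 0) : f y = f 1 := by
  obtain ⟨p, hp, hpf⟩ := hf
  have hζ0 : ζ ≠ 0 := hζ.ne_zero hq.ne'
  have hcomp : p.comp (C ζ * X) = C (ζ ^ d) * p := by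
    refine Polynomial.eq_of_infinite_eval_eq _ _ ((Set.finite_singleton (0 : ℂ)).infinite_compl.mono
      fun y hy => ?_)
    have hy : y ≠ 0 := hy
    simp only [Set.mem_ofPred_eq, eval_comp, eval_mul, eval_C, eval_X]
    rw [← hpf y hy, ← hpf _ (mul_ne_zero hζ0 hy), hinv y hy]
    ring
  have hcoeff : ∀ k, k ≠ d → p.coeff k = 0 := by
    intro k hk
    by_cases hkd : 2 * d < k
    · exact coeff_eq_zero_of_natDegree_lt (hp.trans_lt hkd)
    have h1 := congrArg (fun r => r.coeff k) hcomp
    simp only [comp_C_mul_X_coeff, coeff_C_mul] at h1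
    have h2 : p.coeff k * (ζ ^ k - ζ ^ d) = 0 := by linear_combination h1
    rcases mul_eq_zero.1 h2 with h3 | h3
    · exact h3
    have h4 : k % q = d % q := by
      have h5 : ζ ^ (k % q) = ζ ^ (d % q) := by
        rw [← pow_eq_pow_mod k hζ.pow_eq_one, ← pow_eq_pow_mod d hζ.pow_eq_one, sub_eq_zero.1 h3]
      exact hζ.pow_inj (Nat.mod_lt _ hq) (Nat.mod_lt _ hq) h5
    have hdq : d < q := by omega
    rw [Nat.mod_eq_of_lt hdq] at h4
    by_cases hkq : k < q
    · rw [Nat.mod_eq_of_lt hkq] at h4; exact absurd h4 hk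
    · have : k = q := by omega
      rw [this, Nat.mod_self] at h4
      omega
  have hval : ∀ y, p.eval y = p.coeff d * y ^ d := by
    intro y
    rw [eval_eq_sum_range' (n := 2 * d + 1) (by omega)]
    refine Finset.sum_eq_single d (fun k _ hk => by simp [hcoeff k hk]) fun h => ?_
    exact absurd (Finset.mem_range.2 (by omega)) h
  have key : ∀ y ≠ 0, f y = p.coeff d := fun y hy => by
    have h := hpf y hy
    rw [hval] at h
    exact mul_right_cancel₀ (pow_ne_zero d hy) h
  rw [key y hy, key 1 one_ne_zero]

lemma sum_pow_mul_inv_pow (hζ : IsPrimitiveRoot ζ q) {k l : ℕ} (hk : k < q) (hl : l < q) :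
    ∑ j ∈ Finset.range q, (ζ ^ j) ^ l * ((ζ ^ j) ^ k)⁻¹ = if l = k then (q : ℂ) else 0 := by
  have hζ0 : ζ ≠ 0 := hζ.ne_zero (by omega)
  have h : ∀ j, (ζ ^ j) ^ l * ((ζ ^ j) ^ k)⁻¹ = (ζ ^ l * (ζ ^ k)⁻¹) ^ j := fun j => by
    rw [mul_pow, inv_pow, ← pow_mul, ← pow_mul, ← pow_mul, ← pow_mul, mul_comm j l, mul_comm j k]
  simp_rw [h]
  split_ifs with hlk
  · subst hlk
    simp [mul_inv_cancel₀ (pow_ne_zero l hζ0)]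
  · have h1 : ζ ^ l * (ζ ^ k)⁻¹ - 1 ≠ 0 := fun h0 => hlk (hζ.pow_inj hl hk (by
      have := sub_eq_zero.1 h0
      field_simp at this
      exact this))
    refine mul_right_cancel₀ h1 ?_
    rw [geom_sum_mul, mul_pow, inv_pow, ← pow_mul, ← pow_mul, mul_comm l, mul_comm k, pow_mul,
      pow_mul, hζ.pow_eq_one]
    simp

/-- A Laurent polynomial of low degree is controlled by its values at equally spaced points of
the unit circle. -/
lemma norm_le (hf : LaurentBounded d f) (hζ : IsPrimitiveRoot ζ q) (hd : 2 * d < q) {y₀ : ℂ}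
    (hy₀ : ‖y₀‖ = 1) {m : ℝ} (hm : ∀ j < q, ‖f (ζ ^ j * y₀)‖ ≤ m) {y : ℂ} (hy : y ≠ 0) {c : ℝ}
    (hc : ‖y‖ ≤ c) (hc' : ‖y‖⁻¹ ≤ c) : ‖f y‖ ≤ q * c ^ d * m := by
  obtain ⟨p, hp, hpf⟩ := hf
  have hq : 0 < q := by omega
  have hζ0 : ζ ≠ 0 := hζ.ne_zero hq.ne'
  have hζ1 : ‖ζ‖ = 1 := Complex.norm_eq_one_of_pow_eq_one hζ.pow_eq_one hq.ne'
  have hy₀0 : y₀ ≠ 0 := by rintro rfl; simp at hy₀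
  have hm0 : 0 ≤ m := (norm_nonneg _).trans (hm 0 hq)
  have hcoeff : ∀ k < q, ‖p.coeff k‖ ≤ m := by
    intro k hk
    have h1 : ∑ j ∈ Finset.range q, p.eval (ζ ^ j * y₀) * ((ζ ^ j * y₀) ^ k)⁻¹ =
        q * p.coeff k := by
      have h2 : ∀ j, p.eval (ζ ^ j * y₀) * ((ζ ^ j * y₀) ^ k)⁻¹ = ∑ l ∈ Finset.range q,
          p.coeff l * y₀ ^ l * (y₀ ^ k)⁻¹ * ((ζ ^ j) ^ l * ((ζ ^ j) ^ k)⁻¹) := fun j => by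
        rw [eval_eq_sum_range' (n := q) (by omega), Finset.sum_mul]
        refine Finset.sum_congr rfl fun l _ => ?_
        rw [mul_pow, mul_pow, mul_inv]
        ring
      simp_rw [h2]
      rw [Finset.sum_comm]
      simp_rw [← Finset.mul_sum]
      rw [Finset.sum_eq_single k]
      · rw [sum_pow_mul_inv_pow hζ hk hk, if_pos rfl]
        field_simp
      · intro l hl hlk
        rw [sum_pow_mul_inv_pow hζ hk (Finset.mem_range.1 hl), if_neg hlk, mul_zero]
      · intro h
        exact absurd (Finset.mem_range.2 hk) h
    have h3 : ‖(q : ℂ) * p.coeff k‖ ≤ q * m := by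
      rw [← h1]
      refine (norm_sum_le _ _).trans ?_
      calc ∑ j ∈ Finset.range q, ‖p.eval (ζ ^ j * y₀) * ((ζ ^ j * y₀) ^ k)⁻¹‖
          ≤ ∑ _j ∈ Finset.range q, m := Finset.sum_le_sum fun j hj => by
            rw [← hpf _ (mul_ne_zero (pow_ne_zero j hζ0) hy₀0)]
            simpa [hζ1, hy₀] using hm j (Finset.mem_range.1 hj)
        _ = q * m := by simp
    rw [norm_mul, Complex.norm_natCast] at h3
    exact le_of_mul_le_mul_left h3 (by exact_mod_cast hq)
  have hn : 0 < ‖y‖ := norm_pos_iff.2 hy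
  have hc0 : 0 < c := hn.trans_le hc
  have hc1 : 1 ≤ c := by
    by_contra! h
    have h1 : (1 : ℝ) < ‖y‖⁻¹ := (one_lt_inv₀ hn).2 (hc.trans_lt h)
    linarith
  have h4 : ‖f y‖ * ‖y‖ ^ d ≤ (q * c ^ d * m) * ‖y‖ ^ d := by
    rw [← norm_pow, ← norm_mul, hpf y hy, eval_eq_sum_range' (n := 2 * d + 1) (by omega)]
    refine (norm_sum_le _ _).trans ?_
    calc ∑ k ∈ Finset.range (2 * d + 1), ‖p.coeff k * y ^ k‖
        ≤ ∑ _k ∈ Finset.range (2 * d + 1), m * (c ^ d * ‖y‖ ^ d) := by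
          refine Finset.sum_le_sum fun k hk => ?_
          have hk' := Finset.mem_range.1 hk
          rw [norm_mul, norm_pow]
          refine mul_le_mul (hcoeff k (by omega)) ?_ (by positivity) hm0
          rcases le_total k d with hkd | hkd
          · obtain ⟨i, rfl⟩ := Nat.exists_eq_add_of_le hkd
            calc ‖y‖ ^ k = (‖y‖⁻¹) ^ i * ‖y‖ ^ (k + i) := by
                  rw [pow_add, inv_pow]; field_simp
              _ ≤ c ^ (k + i) * ‖y‖ ^ (k + i) := by
                  gcongr
                  exact (pow_le_pow_left₀ (by positivity) hc' i).trans
                    (pow_le_pow_right₀ hc1 (by omega))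
          · obtain ⟨i, rfl⟩ := Nat.exists_eq_add_of_le hkd
            rw [pow_add, mul_comm]
            gcongr
            exact (pow_le_pow_left₀ (by positivity) hc i).trans
              (pow_le_pow_right₀ hc1 (by omega))
      _ = ((2 * d + 1 : ℕ) : ℝ) * (m * (c ^ d * ‖y‖ ^ d)) := by simp
      _ ≤ q * (m * (c ^ d * ‖y‖ ^ d)) := by
          gcongr
          omega
      _ = _ := by rw [norm_pow]; ring
  exact le_of_mul_le_mul_right h4 (by positivity)

end LaurentBounded

end Laurent

section Weights

/-- The edge weight `(1 + λ y) (1 + λ / y)`, equal to `|1 + λ y| ^ 2` on the unit circle. -/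
noncomputable def edge (lam : ℝ) (y : ℂ) : ℂ := (1 + lam * y) * (1 + lam * y⁻¹)

lemma laurentBounded_edge (lam : ℝ) : LaurentBounded 1 (edge lam) := by
  refine ⟨(1 + C (lam : ℂ) * X) * (X + C (lam : ℂ)), ?_, fun y hy => ?_⟩
  · compute_degree
  · simp [edge]
    field_simp

/-- The edge weights along the orbit of `y` under rotation by `ζ`. -/
noncomputable def weights (lam : ℝ) (ζ y : ℂ) (k : ℕ) : ℂ := edge lam (ζ ^ k * y)

lemma weights_mul (lam : ℝ) (ζ y : ℂ) (k j : ℕ) :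
    weights lam ζ (ζ ^ j * y) k = weights lam ζ y (k + j) := by
  rw [weights, weights, pow_add, mul_assoc]

lemma weights_shift (lam : ℝ) (ζ y : ℂ) (j : ℕ) :
    (fun k => weights lam ζ y (k + j)) = weights lam ζ (ζ ^ j * y) :=
  funext fun k => (weights_mul lam ζ y k j).symm

lemma weights_add_period {q : ℕ} {ζ : ℂ} (hζ : ζ ^ q = 1) (lam : ℝ) (y : ℂ) (k : ℕ) :
    weights lam ζ y (k + q) = weights lam ζ y k := by
  rw [weights, weights, pow_add, hζ, mul_one]

lemma laurentBounded_continuant (lam : ℝ) {ζ : ℂ} (hζ : ζ ≠ 0) (E : ℂ) (n : ℕ) :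
    LaurentBounded (n / 2) fun y => continuant E (weights lam ζ y) n := by
  induction n using Nat.strong_induction_on with
  | _ n ih =>
    match n with
    | 0 => simpa [continuant_zero] using LaurentBounded.const 1
    | 1 => simpa [continuant_one] using LaurentBounded.const E
    | n + 2 =>
      simp_rw [continuant_add_two]
      refine LaurentBounded.sub ?_ ?_
      · exact ((LaurentBounded.const E).mul (ih (n + 1) (by omega))).mono (by omega)
      · exact ((((laurentBounded_edge lam).comp_mul (pow_ne_zero (n + 1) hζ))).mul
          (ih n (by omega))).mono (by omega)

lemma laurentBounded_trace (lam : ℝ) {ζ : ℂ} (hζ : ζ ≠ 0) (E : ℂ) (n : ℕ) :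
    LaurentBounded ((n + 2) / 2) fun y => (cocycle E (weights lam ζ y) (n + 2)).trace := by
  simp_rw [trace_cocycle, weights_shift]
  refine LaurentBounded.sub (laurentBounded_continuant lam hζ E (n + 2)) ?_
  have h1 := (laurentBounded_edge lam).comp_mul (pow_ne_zero 0 hζ)
  have h2 := (laurentBounded_continuant lam hζ E n).comp_mul (pow_ne_zero 1 hζ)
  exact (h1.mul h2).mono (by omega)

/-- The discriminant does not depend on the phase. -/
lemma trace_weights_eq {q : ℕ} (hq : 2 ≤ q) {ζ : ℂ} (hζ : IsPrimitiveRoot ζ q) (lam : ℝ) (E : ℂ)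
    {y : ℂ} (hy : y ≠ 0) :
    (cocycle E (weights lam ζ y) q).trace = (cocycle E (weights lam ζ 1) q).trace := by
  obtain ⟨n, rfl⟩ := Nat.exists_eq_add_of_le' hq
  refine (laurentBounded_trace lam (hζ.ne_zero (by omega)) E n).eq_of_invariant hζ (by omega)
    (by omega) (fun y _ => ?_) hy
  have h := trace_cocycle_shift E (weights lam ζ y) (n + 2)
    (weights_add_period hζ.pow_eq_one lam y) 1
  rwa [weights_shift, pow_one] at h

lemma prod_one_add_mul {q : ℕ} (hq : 0 < q) {ζ : ℂ} (hζ : IsPrimitiveRoot ζ q) (x : ℂ) :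
    ∏ k ∈ Finset.range q, (1 + x * ζ ^ k) = 1 - (-x) ^ q := by
  have h := hζ.pow_sub_pow_eq_prod_sub_mul 1 (-x) hq
  rw [one_pow] at h
  rw [h]
  refine Finset.prod_nbij (fun k => ζ ^ k) ?_ ?_ ?_ ?_
  · intro k _
    rw [mem_nthRootsFinset hq, ← pow_mul, mul_comm, pow_mul, hζ.pow_eq_one, one_pow]
  · intro a ha b hb hab
    simp only [Finset.coe_range, Set.mem_Iio] at ha hb
    exact hζ.pow_inj ha hb hab
  · intro z hz
    rw [Finset.mem_coe, mem_nthRootsFinset hq] at hz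
    have : NeZero q := ⟨hq.ne'⟩
    obtain ⟨i, hi, rfl⟩ := hζ.eq_pow_of_pow_eq_one hz
    exact ⟨i, by simpa using hi, rfl⟩
  · intro k _
    ring

lemma prod_hop {q : ℕ} (hq : 0 < q) {ζ : ℂ} (hζ : IsPrimitiveRoot ζ q) (lam : ℝ) (y : ℂ) :
    ∏ k ∈ Finset.range q, (1 + lam * (ζ ^ k * y)) = 1 - (-lam) ^ q * y ^ q := by
  have h := prod_one_add_mul hq hζ (lam * y)
  rw [show -((lam : ℂ) * y) = -lam * y by ring, mul_pow] at h
  rw [← h]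
  exact Finset.prod_congr rfl fun k _ => by ring

lemma prod_hop_inv {q : ℕ} (hq : 0 < q) {ζ : ℂ} (hζ : IsPrimitiveRoot ζ q) (lam : ℝ) (y : ℂ) :
    ∏ k ∈ Finset.range q, (1 + lam * (ζ ^ k * y)⁻¹) = 1 - (-lam) ^ q * (y ^ q)⁻¹ := by
  have h := prod_hop hq hζ.inv lam y⁻¹
  rw [inv_pow] at h
  rw [← h]
  exact Finset.prod_congr rfl fun k _ => by rw [mul_inv, inv_pow]

lemma prod_weights {q : ℕ} (hq : 0 < q) {ζ : ℂ} (hζ : IsPrimitiveRoot ζ q) (lam : ℝ) (y : ℂ) :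
    ∏ k ∈ Finset.range q, weights lam ζ y k =
      (1 - (-lam) ^ q * y ^ q) * (1 - (-lam) ^ q * (y ^ q)⁻¹) := by
  rw [← prod_hop hq hζ, ← prod_hop_inv hq hζ, ← Finset.prod_mul_distrib]
  rfl

/-- The edge weight at a point of the unit circle, as a real number. -/
noncomputable def realWeights (lam : ℝ) (ζ y : ℂ) (k : ℕ) : ℝ := ‖1 + lam * (ζ ^ k * y)‖ ^ 2

lemma weights_eq_ofReal (lam : ℝ) {ζ y : ℂ} (hζ : ‖ζ‖ = 1) (hy : ‖y‖ = 1) (k : ℕ) :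
    weights lam ζ y k = (realWeights lam ζ y k : ℂ) := by
  have h : (ζ ^ k * y)⁻¹ = (starRingEnd ℂ) (ζ ^ k * y) :=
    Complex.inv_eq_conj (by rw [norm_mul, norm_pow, hζ, hy, one_pow, mul_one])
  rw [weights, edge, realWeights, h, Complex.ofReal_pow, ← Complex.mul_conj']
  simp

lemma realWeights_nonneg (lam : ℝ) (ζ y : ℂ) (k : ℕ) : 0 ≤ realWeights lam ζ y k := by
  rw [realWeights]; positivity

lemma realWeights_le {lam : ℝ} (hlam : 0 < lam) {ζ y : ℂ} (hζ : ‖ζ‖ = 1) (hy : ‖y‖ = 1) (k : ℕ) :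
    realWeights lam ζ y k ≤ (1 + lam) ^ 2 := by
  rw [realWeights]
  gcongr
  refine (norm_add_le _ _).trans ?_
  simp [hζ, hy, abs_of_pos hlam]

lemma realWeights_add_period {q : ℕ} {ζ : ℂ} (hζ : ζ ^ q = 1) (lam : ℝ) (y : ℂ) (k : ℕ) :
    realWeights lam ζ y (k + q) = realWeights lam ζ y k := by
  rw [realWeights, realWeights, pow_add, hζ, mul_one]

end Weights

section Eigenvectors

variable {b : ℕ → ℝ} {E : ℂ} {q : ℕ} {v : Fin 2 → ℂ}

lemma transfer_mulVec (E b : ℂ) (w : Fin 2 → ℂ) :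
    transfer E b *ᵥ w = ![E * w 0 - b * w 1, w 0] := by
  ext i
  fin_cases i <;> simp [transfer, Matrix.mulVec, dotProduct, Fin.sum_univ_two, sub_eq_add_neg]

lemma cocycle_succ_mulVec_zero (E : ℂ) (b : ℕ → ℂ) (n : ℕ) (v : Fin 2 → ℂ) :
    (cocycle E b (n + 1) *ᵥ v) 0 =
      E * (cocycle E b n *ᵥ v) 0 - b n * (cocycle E b n *ᵥ v) 1 := by
  rw [cocycle_succ, ← Matrix.mulVec_mulVec, transfer_mulVec]
  rfl

lemma cocycle_succ_mulVec_one (E : ℂ) (b : ℕ → ℂ) (n : ℕ) (v : Fin 2 → ℂ) :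
    (cocycle E b (n + 1) *ᵥ v) 1 = (cocycle E b n *ᵥ v) 0 := by
  rw [cocycle_succ, ← Matrix.mulVec_mulVec, transfer_mulVec]
  rfl

/-- The current `Im (v 0 * conj (v 1))`, whose growth detects non-real energies. -/
def current (v : Fin 2 → ℂ) : ℝ := (v 0 * (starRingEnd ℂ) (v 1)).im

lemma current_cocycle_succ (E : ℂ) (b : ℕ → ℝ) (n : ℕ) (v : Fin 2 → ℂ) :
    current (cocycle E (fun k => (b k : ℂ)) (n + 1) *ᵥ v) =
      b n * current (cocycle E (fun k => (b k : ℂ)) n *ᵥ v) +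
        E.im * ‖(cocycle E (fun k => (b k : ℂ)) n *ᵥ v) 0‖ ^ 2 := by
  rw [current, cocycle_succ_mulVec_zero, cocycle_succ_mulVec_one, current, ← Complex.normSq_eq_norm_sq,
    Complex.normSq_apply]
  simp
  ring

lemma exists_eigenvector {M : Matrix (Fin 2) (Fin 2) ℂ} {μ : ℂ} (hdet : M.det = μ ^ 2)
    (htr : M.trace = 2 * μ) : ∃ v ≠ 0, M *ᵥ v = μ • v := by
  have h : (M - μ • (1 : Matrix (Fin 2) (Fin 2) ℂ)).det = 0 := by
    rw [Matrix.det_fin_two] at hdet ⊢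
    rw [Matrix.trace_fin_two] at htr
    simp
    linear_combination hdet - μ * htr
  obtain ⟨v, hv, hv'⟩ := Matrix.exists_mulVec_eq_zero_iff.2 h
  refine ⟨v, hv, ?_⟩
  rw [Matrix.sub_mulVec, Matrix.smul_mulVec, Matrix.one_mulVec] at hv'
  exact sub_eq_zero.1 hv'

lemma im_eq_zero_of_mulVec_eq (hb : ∀ k, 0 < b k) (hq : 2 ≤ q) {μ : ℝ}
    (hμ : ∏ k ∈ Finset.range q, b k = μ ^ 2) (hv : v ≠ 0)
    (h : cocycle E (fun k => (b k : ℂ)) q *ᵥ v = (μ : ℂ) • v) : E.im = 0 := by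
  set w : ℕ → Fin 2 → ℂ := fun n => cocycle E (fun k => (b k : ℂ)) n *ᵥ v with hw
  have hw0 : w 0 = v := by
    simp only [hw, cocycle_zero, Matrix.one_mulVec]
  let S : ℕ → ℝ := fun n => Nat.rec 0 (fun k s => ‖w k 0‖ ^ 2 + b k * s) n
  have hS : ∀ n, S (n + 1) = ‖w n 0‖ ^ 2 + b n * S n := fun n => rfl
  have hS0 : S 0 = 0 := rfl
  have hcur : ∀ n, current (w n) = (∏ k ∈ Finset.range n, b k) * current v + E.im * S n := by
    intro n
    induction n with
    | zero => simp [hw0, hS0]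
    | succ n ih =>
      rw [hS, Finset.prod_range_succ, current_cocycle_succ E b n v]
      change b n * current (w n) + E.im * ‖w n 0‖ ^ 2 = _
      rw [ih]
      ring
  have hpos : ∀ n, 0 < S (n + 2) := by
    intro n
    induction n with
    | zero =>
      have h1 : w 1 0 = E * v 0 - b 0 * v 1 := by
        simp only [hw]
        rw [cocycle_succ_mulVec_zero, cocycle_zero, Matrix.one_mulVec]
      have h2 : S (0 + 2) = ‖E * v 0 - b 0 * v 1‖ ^ 2 + b 1 * ‖v 0‖ ^ 2 := by
        rw [hS (0 + 1), hS 0, hS0, mul_zero, add_zero, hw0, zero_add, h1]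
      rw [h2]
      have hb1 := hb 1
      by_cases hv0 : v 0 = 0
      · have hv1 : v 1 ≠ 0 := fun hv1 => hv (by ext i; fin_cases i <;> simp [hv0, hv1])
        have h3 : 0 < ‖E * v 0 - b 0 * v 1‖ := by
          rw [norm_pos_iff, hv0]
          simp [hv1, (hb 0).ne']
        positivity
      · have : 0 < ‖v 0‖ := norm_pos_iff.2 hv0
        positivity
    | succ n ih =>
      rw [hS]
      have := mul_pos (hb (n + 2)) ih
      positivity
  obtain ⟨n, rfl⟩ := Nat.exists_eq_add_of_le' hq
  have h1 := hcur (n + 2)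
  have h2 : current (w (n + 2)) = μ ^ 2 * current v := by
    change current (cocycle E (fun k => (b k : ℂ)) (n + 2) *ᵥ v) = _
    rw [h]
    simp [current]
    ring
  rw [h2, hμ] at h1
  have h3 : E.im * S (n + 2) = 0 := by linarith
  exact (mul_eq_zero.1 h3).resolve_right (hpos n).ne'

lemma norm_le_of_mulVec_eq {s : ℝ} (hs : 0 < s) (hb : ∀ k, 0 ≤ b k) (hbs : ∀ k, b k ≤ s ^ 2)
    (hq : q ≠ 0) {μ : ℝ} (hμ0 : μ ≠ 0) (hμ : ∏ k ∈ Finset.range q, b k = μ ^ 2) (hv : v ≠ 0)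
    (h : cocycle E (fun k => (b k : ℂ)) q *ᵥ v = (μ : ℂ) • v) : ‖E‖ ≤ 2 * s := by
  by_contra! hE
  set t := ‖E‖ - s with ht
  have hst : s < t := by linarith
  have hμs : |μ| ≤ s ^ q := by
    refine abs_le_of_sq_le_sq ?_ (by positivity)
    rw [← hμ, ← pow_mul, mul_comm, pow_mul]
    calc ∏ k ∈ Finset.range q, b k ≤ ∏ _k ∈ Finset.range q, s ^ 2 :=
          Finset.prod_le_prod (fun k _ => hb k) fun k _ => hbs k
      _ = (s ^ 2) ^ q := by simp
  have hstq : s ^ q < t ^ q := pow_lt_pow_left₀ hst hs.le hq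
  have hstep : ∀ (x y : ℂ) (k : ℕ), ‖E‖ * ‖x‖ - b k * ‖y‖ ≤ ‖E * x - b k * y‖ := fun x y k => by
    have := norm_sub_norm_le (E * x) (b k * y)
    rwa [norm_mul, norm_mul, Complex.norm_real, Real.norm_of_nonneg (hb k)] at this
  set w : ℕ → Fin 2 → ℂ := fun n => cocycle E (fun k => (b k : ℂ)) n *ᵥ v with hw
  have hw0 : w 0 = v := by
    simp only [hw, cocycle_zero, Matrix.one_mulVec]
  have hwq : w q = (μ : ℂ) • v := h
  have hws0 : ∀ n, w (n + 1) 0 = E * w n 0 - b n * w n 1 :=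
    fun n => cocycle_succ_mulVec_zero E _ n v
  have hws1 : ∀ n, w (n + 1) 1 = w n 0 := fun n => cocycle_succ_mulVec_one E _ n v
  rcases le_or_gt (s * ‖v 1‖) ‖v 0‖ with hc | hc
  · have hfwd : ∀ n, s * ‖w n 1‖ ≤ ‖w n 0‖ ∧ t ^ n * ‖v 0‖ ≤ ‖w n 0‖ := by
      intro n
      induction n with
      | zero => simpa [hw0] using hc
      | succ n ih =>
        rw [hws0, hws1]
        have h1 := hstep (w n 0) (w n 1) n
        have h2 : b n * ‖w n 1‖ ≤ s * ‖w n 0‖ := by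
          calc b n * ‖w n 1‖ ≤ s ^ 2 * ‖w n 1‖ := by gcongr; exact hbs n
            _ = s * (s * ‖w n 1‖) := by ring
            _ ≤ s * ‖w n 0‖ := by gcongr; exact ih.1
        have h3 : t * ‖w n 0‖ ≤ ‖E * w n 0 - b n * w n 1‖ := by rw [ht]; linarith
        refine ⟨le_trans (by gcongr) h3, le_trans ?_ h3⟩
        rw [pow_succ', mul_assoc]
        have : 0 < t := hs.trans hst
        gcongr
        exact ih.2
    have hv0 : 0 < ‖v 0‖ := by
      rw [norm_pos_iff]
      intro hv0
      rw [hv0, norm_zero] at hc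
      have : v 1 = 0 := norm_le_zero_iff.1 (by nlinarith [norm_nonneg (v 1)])
      exact hv (by ext i; fin_cases i <;> simp [hv0, this])
    have h1 := (hfwd q).2
    rw [hwq, Pi.smul_apply, norm_smul, Complex.norm_real, Real.norm_eq_abs] at h1
    have := le_of_mul_le_mul_right h1 hv0
    linarith
  · have hbwd : ∀ n, ‖w n 0‖ < s * ‖w n 1‖ →
        t ^ n * ‖w n 1‖ ≤ (∏ k ∈ Finset.range n, b k) * ‖v 1‖ := by
      intro n
      induction n with
      | zero => simp [hw0]
      | succ n ih =>
        rw [hws0, hws1]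
        intro hn
        have h1 := hstep (w n 0) (w n 1) n
        have h2 : t * ‖w n 0‖ < b n * ‖w n 1‖ := by rw [ht]; linarith
        have h3 : s * ‖w n 0‖ ≤ t * ‖w n 0‖ := by gcongr
        have h4 : b n * ‖w n 1‖ ≤ s ^ 2 * ‖w n 1‖ := by gcongr; exact hbs n
        have h5 : ‖w n 0‖ < s * ‖w n 1‖ := by
          refine lt_of_mul_lt_mul_left (a := s) ?_ hs.le
          rw [← mul_assoc, ← sq]
          linarith
        have h6 := ih h5
        have : 0 < t := hs.trans hst
        calc t ^ (n + 1) * ‖w n 0‖ = t ^ n * (t * ‖w n 0‖) := by ring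
          _ ≤ t ^ n * (b n * ‖w n 1‖) := by gcongr
          _ = b n * (t ^ n * ‖w n 1‖) := by ring
          _ ≤ b n * ((∏ k ∈ Finset.range n, b k) * ‖v 1‖) := by gcongr; exact hb n
          _ = _ := by rw [Finset.prod_range_succ]; ring
    have hμpos : 0 < |μ| := abs_pos.2 hμ0
    have hv1 : 0 < ‖v 1‖ := by
      by_contra! h0
      nlinarith [norm_nonneg (v 0)]
    have h1 := hbwd q (by
      rw [hwq, Pi.smul_apply, Pi.smul_apply, norm_smul, norm_smul, Complex.norm_real,
        Real.norm_eq_abs]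
      nlinarith)
    rw [hwq, Pi.smul_apply, norm_smul, Complex.norm_real, Real.norm_eq_abs, hμ, ← sq_abs] at h1
    have h2 : t ^ q * (|μ| * ‖v 1‖) ≤ |μ| * (|μ| * ‖v 1‖) := by linarith [h1, sq (|μ|)]
    have := le_of_mul_le_mul_right h2 (by positivity)
    linarith

end Eigenvectors

section Signs

variable {b : ℕ → ℝ} {E : ℝ} {q : ℕ}

lemma prod_range_shift (hb : ∀ k, b (k + q) = b k) (hpos : ∀ k, 0 < b k) (j : ℕ) :
    ∏ k ∈ Finset.range q, b (k + j) = ∏ k ∈ Finset.range q, b k := by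
  induction j with
  | zero => rfl
  | succ j ih =>
    rw [← ih]
    have h1 := Finset.prod_range_succ (fun k => b (k + j)) q
    have h2 := Finset.prod_range_succ' (fun k => b (k + j)) q
    rw [h1] at h2
    have h3 : b (q + j) = b (0 + j) := by rw [← hb (0 + j)]; congr 1; ring
    rw [h3] at h2
    refine mul_right_cancel₀ (hpos (0 + j)).ne' (Eq.trans ?_ h2.symm)
    congr 1
    exact Finset.prod_congr rfl fun k _ => by congr 1; ring

lemma continuant_mul_continuant_pos (hq : 0 < q) (hb : ∀ k, b (k + q) = b k)
    (hpos : ∀ k, 0 < b k)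
    (htr : (cocycle E b q).trace ^ 2 < 4 * ∏ k ∈ Finset.range q, b k) (j : ℕ) :
    0 < continuant E (fun k => b (k + j)) (q - 1) *
      continuant E (fun k => b (k + (j + 1))) (q - 1) := by
  obtain ⟨n, rfl⟩ := Nat.exists_eq_add_of_le' hq
  rw [Nat.add_sub_cancel]
  have h1 := det_cocycle E (fun k => b (k + j)) (n + 1)
  rw [prod_range_shift hb hpos, Matrix.det_fin_two, cocycle_one_zero, cocycle_zero_one] at h1
  rw [← trace_cocycle_shift E b (n + 1) hb j, Matrix.trace_fin_two, ← h1] at htr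
  have h2 : (fun k => b (k + 1 + j)) = fun k => b (k + (j + 1)) := by
    funext k; congr 1; ring
  rw [h2] at htr
  have h3 := hpos (0 + j)
  set x := cocycle E (fun k => b (k + j)) (n + 1) 0 0
  set y := cocycle E (fun k => b (k + j)) (n + 1) 1 1
  set m := continuant E (fun k => b (k + j)) n
  set m' := continuant E (fun k => b (k + (j + 1))) n
  have h4 : 0 < b (0 + j) * (m * m') := by nlinarith [sq_nonneg (x - y)]
  exact (mul_pos_iff_of_pos_left h3).1 h4

/-- Inside the bands all corank-one minors have the same sign, so each of them is bounded by the
derivative of the discriminant. -/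
lemma abs_continuant_le (hq : 0 < q) (hb : ∀ k, b (k + q) = b k) (hpos : ∀ k, 0 < b k)
    (htr : (cocycle E b q).trace ^ 2 < 4 * ∏ k ∈ Finset.range q, b k) (j : ℕ) :
    |continuant E (fun k => b (k + (j + 1))) (q - 1)| ≤
      |(derivative (cocycle (X : ℝ[X]) (fun k => C (b k)) q).trace).eval E| := by
  have heval : (derivative (cocycle (X : ℝ[X]) (fun k => C (b k)) q).trace).eval E =
      ∑ s ∈ Finset.range q, continuant E (fun k => b (k + (s + 1))) (q - 1) := by
    rw [derivative_trace_cocycle b q hb, eval_finsetSum]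
    refine Finset.sum_congr rfl fun s _ => ?_
    have := continuant_map (Polynomial.evalRingHom E) X (fun k => C (b (k + (s + 1)))) (q - 1)
    simpa using this
  rw [heval]
  set m : ℕ → ℝ := fun s => continuant E (fun k => b (k + s)) (q - 1) with hm
  change |m (j + 1)| ≤ |∑ s ∈ Finset.range q, m (s + 1)|
  have hmm : ∀ s, 0 < m s * m (s + 1) := continuant_mul_continuant_pos hq hb hpos htr
  have hper : ∀ s, m (s + q) = m s := fun s => by
    simp only [hm]
    congr 1
    funext k
    rw [← add_assoc, hb]
  have hmod : m (j + 1) = m (j % q + 1) := by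
    have : ∀ i r, m (r + 1 + i * q) = m (r + 1) := fun i r => by
      induction i with
      | zero => simp
      | succ i ih => rw [add_mul, one_mul, ← add_assoc, hper, ih]
    rw [← this (j / q) (j % q)]
    congr 1
    have := Nat.mod_add_div j q
    rw [mul_comm] at this
    omega
  have hmem : j % q ∈ Finset.range q := Finset.mem_range.2 (Nat.mod_lt _ hq)
  rw [hmod]
  have h0 : m 0 ≠ 0 := fun h0 => by simpa [h0] using hmm 0
  rcases h0.lt_or_gt with h0 | h0
  · have hneg : ∀ s, m s < 0 := fun s => by
      induction s with
      | zero => exact h0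
      | succ s ih => nlinarith [hmm s]
    rw [abs_of_neg (hneg _), abs_of_nonpos (Finset.sum_nonpos fun s _ => (hneg _).le),
      ← Finset.sum_neg_distrib]
    exact Finset.single_le_sum (f := fun s => -m (s + 1)) (fun s _ => by linarith [hneg (s + 1)]) hmem
  · have hp : ∀ s, 0 < m s := fun s => by
      induction s with
      | zero => exact h0
      | succ s ih => exact (mul_pos_iff_of_pos_left ih).1 (hmm s)
    rw [abs_of_pos (hp _), abs_of_nonneg (Finset.sum_nonneg fun s _ => (hp _).le)]
    exact Finset.single_le_sum (f := fun s => m (s + 1)) (fun s _ => (hp _).le) hmem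

end Signs

section Discriminant

lemma monic_continuant {R : Type*} [CommRing R] [Nontrivial R] (b : ℕ → R) (n : ℕ) :
    (continuant (X : R[X]) (fun k => C (b k)) n).Monic ∧
      (continuant (X : R[X]) (fun k => C (b k)) n).natDegree = n := by
  induction n using Nat.twoStepInduction with
  | zero => simp [continuant_zero]
  | one => simp [continuant_one, monic_X]
  | more n ih0 ih1 =>
    rw [continuant_add_two]
    set p := continuant (X : R[X]) (fun k => C (b k)) n
    set r := continuant (X : R[X]) (fun k => C (b k)) (n + 1)
    have hX : (X * r).Monic := monic_X.mul ih1.1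
    have hdeg : (X * r).natDegree = n + 2 := by
      rw [monic_X.natDegree_mul ih1.1, natDegree_X, ih1.2]
      ring
    have hlt : (C (b (n + 1)) * p).natDegree < (X * r).natDegree := by
      rw [hdeg]
      exact (natDegree_C_mul_le _ _).trans_lt (by omega)
    have hlt' := degree_lt_degree hlt
    exact ⟨hX.sub_of_left hlt', by rw [natDegree_sub_eq_left_of_natDegree_lt hlt, hdeg]⟩

lemma monic_trace_cocycle {R : Type*} [CommRing R] [Nontrivial R] (b : ℕ → R) {q : ℕ}
    (hq : 2 ≤ q) :
    (cocycle (X : R[X]) (fun k => C (b k)) q).trace.Monic ∧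
      (cocycle (X : R[X]) (fun k => C (b k)) q).trace.natDegree = q := by
  obtain ⟨n, rfl⟩ := Nat.exists_eq_add_of_le' hq
  rw [trace_cocycle]
  have h1 := monic_continuant b (n + 2)
  have h2 := monic_continuant (fun k => b (k + 1)) n
  have hlt : (C (b 0) * continuant (X : R[X]) (fun k => C (b (k + 1))) n).natDegree <
      (continuant (X : R[X]) (fun k => C (b k)) (n + 2)).natDegree := by
    rw [h1.2]
    exact (natDegree_C_mul_le _ _).trans_lt (by omega)
  exact ⟨h1.1.sub_of_left (degree_lt_degree hlt),
    by rw [natDegree_sub_eq_left_of_natDegree_lt hlt, h1.2]⟩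

lemma continuant_add_two' {R : Type*} [CommRing R] (E : R) (b : ℕ → R) (n : ℕ) :
    continuant E b (n + 2) = E * continuant E (fun k => b (k + 1)) (n + 1) -
      b 1 * continuant E (fun k => b (k + 2)) n := by
  rw [continuant, cocycle_succ', Matrix.mul_apply, Fin.sum_univ_two, cocycle_zero_one]
  simp [continuant, transfer, add_assoc]
  ring

lemma continuant_succ_of_eq_zero {R : Type*} [CommRing R] (E : R) (b : ℕ → R) (n : ℕ)
    (hb : b n = 0) : continuant E b (n + 1) = E * continuant E b n := by
  rw [continuant, cocycle_succ, Matrix.mul_apply, Fin.sum_univ_two]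
  simp [continuant, transfer, hb]

/-- The discriminant of the periodic operator with frequency `ζ`, a `q`-th root of unity. -/
noncomputable def disc (lam : ℝ) (ζ : ℂ) (q : ℕ) : ℝ[X] :=
  (cocycle (X : ℝ[X]) (fun k => C (realWeights lam ζ 1 k)) q).trace

variable {lam : ℝ} {ζ : ℂ} {q : ℕ}

lemma monic_disc (hq : 2 ≤ q) : (disc lam ζ q).Monic := (monic_trace_cocycle _ hq).1

lemma natDegree_disc (hq : 2 ≤ q) : (disc lam ζ q).natDegree = q := (monic_trace_cocycle _ hq).2

lemma aeval_disc (hq : 2 ≤ q) (hζ : IsPrimitiveRoot ζ q) (E : ℂ) {y : ℂ} (hy : y ≠ 0) :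
    aeval E (disc lam ζ q) = (cocycle E (weights lam ζ y) q).trace := by
  have hn : ‖ζ‖ = 1 := hζ.norm'_eq_one (by omega)
  rw [trace_weights_eq hq hζ lam E hy, disc]
  have := trace_cocycle_map (aeval (R := ℝ) E).toRingHom X (fun k => C (realWeights lam ζ 1 k)) q
  simp only [AlgHom.toRingHom_eq_coe, RingHom.coe_coe, aeval_X, aeval_C] at this
  rw [this]
  congr 2
  funext k
  rw [weights_eq_ofReal lam hn (by simp)]
  rfl

lemma map_disc (hq : 2 ≤ q) (hζ : IsPrimitiveRoot ζ q) {y : ℂ} (hy : y ≠ 0) :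
    (disc lam ζ q).map (algebraMap ℝ ℂ) =
      (cocycle (X : ℂ[X]) (fun k => C (weights lam ζ y k)) q).trace := by
  refine Polynomial.funext fun E => ?_
  have := trace_cocycle_map (evalRingHom E) X (fun k => C (weights lam ζ y k)) q
  simp only [coe_evalRingHom, eval_X, eval_C] at this
  rw [this, eval_map_algebraMap, aeval_disc hq hζ E hy]

lemma disc_eq (hq : 2 ≤ q) (hζ : IsPrimitiveRoot ζ q) {y : ℂ} (hy : ‖y‖ = 1) :
    disc lam ζ q = (cocycle (X : ℝ[X]) (fun k => C (realWeights lam ζ y k)) q).trace := by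
  have hn : ‖ζ‖ = 1 := hζ.norm'_eq_one (by omega)
  have hy0 : y ≠ 0 := norm_pos_iff.1 (by rw [hy]; exact one_pos)
  refine map_injective (algebraMap ℝ ℂ) (algebraMap ℝ ℂ).injective ?_
  rw [map_disc hq hζ hy0]
  have := trace_cocycle_map (mapRingHom (algebraMap ℝ ℂ)) X
    (fun k => C (realWeights lam ζ y k)) q
  simp only [coe_mapRingHom, map_X, map_C] at this
  rw [this]
  congr 2
  funext k
  rw [weights_eq_ofReal lam hn hy]
  rfl

/-- A phase for which the hopping terms have maximal product. -/
lemma exists_phase (hlam : 0 < lam) (hq : 0 < q) (hζ : IsPrimitiveRoot ζ q) :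
    ∃ y : ℂ, ‖y‖ = 1 ∧ (∀ k, 0 < realWeights lam ζ y k) ∧
      ∏ k ∈ Finset.range q, realWeights lam ζ y k = (1 + lam ^ q) ^ 2 := by
  obtain ⟨y, hy⟩ := IsAlgClosed.exists_pow_nat_eq (-(-1) ^ q : ℂ) hq
  have hn : ‖ζ‖ = 1 := hζ.norm'_eq_one hq.ne'
  have hy1 : ‖y‖ = 1 := by
    have : ‖y‖ ^ q = 1 := by rw [← norm_pow, hy]; simp
    exact (pow_eq_one_iff_of_nonneg (norm_nonneg _) hq.ne').1 this
  have h1 : ((-1 : ℂ) ^ q) * (-1) ^ q = 1 := by rw [← mul_pow]; simp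
  have h2 : (-(lam : ℂ)) ^ q = (-1) ^ q * lam ^ q := by rw [neg_pow]
  have hprod : ∏ k ∈ Finset.range q, realWeights lam ζ y k = (1 + lam ^ q) ^ 2 := by
    have h := prod_weights hq hζ lam y
    simp only [weights_eq_ofReal lam hn hy1] at h
    have h3 : (y ^ q)⁻¹ = y ^ q := by
      refine inv_eq_of_mul_eq_one_right ?_
      rw [hy]
      linear_combination h1
    rw [h3, hy, h2] at h
    have h4 : (1 - (-1 : ℂ) ^ q * lam ^ q * -(-1) ^ q) = 1 + lam ^ q := by
      linear_combination lam ^ q * h1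
    rw [h4, ← sq] at h
    exact_mod_cast h
  refine ⟨y, hy1, fun k => lt_of_le_of_ne (realWeights_nonneg _ _ _ _) fun h0 => ?_, hprod⟩
  have : ∀ i, realWeights lam ζ y (k % q + i * q) = realWeights lam ζ y (k % q) := fun i => by
    induction i with
    | zero => simp
    | succ i ih => rw [add_mul, one_mul, ← add_assoc, realWeights_add_period hζ.pow_eq_one, ih]
  have h5 := this (k / q)
  rw [mul_comm, Nat.mod_add_div, ← h0] at h5
  rw [Finset.prod_eq_zero (Finset.mem_range.2 (Nat.mod_lt k hq)) h5.symm] at hprod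
  have : 0 < (1 + lam ^ q) ^ 2 := by positivity
  linarith

lemma root_disc_sub (hlam : 0 < lam) (hq : 2 ≤ q) (hζ : IsPrimitiveRoot ζ q) {c : ℝ}
    (hc : |c| = 2 * (1 + lam ^ q)) {E : ℂ} (hE : aeval E (disc lam ζ q) = (c : ℂ)) :
    E.im = 0 ∧ ‖E‖ ≤ 2 * (1 + lam) := by
  obtain ⟨y, hy, hpos, hprod⟩ := exists_phase hlam (by omega) hζ
  have hn : ‖ζ‖ = 1 := hζ.norm'_eq_one (by omega)
  have hy0 : y ≠ 0 := norm_pos_iff.1 (by rw [hy]; exact one_pos)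
  have hμ : ∏ k ∈ Finset.range q, realWeights lam ζ y k = (c / 2) ^ 2 := by
    rw [hprod, div_pow, ← sq_abs c, hc]
    ring
  have hw : weights lam ζ y = fun k => (realWeights lam ζ y k : ℂ) :=
    funext (weights_eq_ofReal lam hn hy)
  obtain ⟨v, hv, h⟩ := exists_eigenvector (μ := ((c / 2 : ℝ) : ℂ))
    (M := cocycle E (fun k => (realWeights lam ζ y k : ℂ)) q)
    (by rw [det_cocycle]; exact_mod_cast hμ)
    (by rw [← hw, ← aeval_disc hq hζ E hy0, hE]; push_cast; ring)
  have hc0 : c / 2 ≠ 0 := by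
    intro h0
    have : c = 0 := by linarith
    rw [this, abs_zero] at hc
    have := pow_pos hlam q
    linarith
  exact ⟨im_eq_zero_of_mulVec_eq hpos hq hμ hv h,
    norm_le_of_mulVec_eq (by linarith) (fun k => (hpos k).le) (realWeights_le hlam hn hy)
      (by omega) hc0 hμ hv h⟩

lemma exists_list_disc_sub (hlam : 0 < lam) (hq : 2 ≤ q) (hζ : IsPrimitiveRoot ζ q) {c : ℝ}
    (hc : |c| = 2 * (1 + lam ^ q)) :
    ∃ l : List ℝ, l.length = q ∧ (∀ r ∈ l, |r| ≤ 2 * (1 + lam)) ∧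
      disc lam ζ q - C c = (l.map fun r => X - C r).prod := by
  have hlt : (C c).natDegree < (disc lam ζ q).natDegree := by
    rw [natDegree_C, natDegree_disc hq]; omega
  have hm : (disc lam ζ q - C c).Monic := (monic_disc hq).sub_of_left (degree_lt_degree hlt)
  have hd : (disc lam ζ q - C c).natDegree = q := by
    rw [natDegree_sub_eq_left_of_natDegree_lt hlt, natDegree_disc hq]
  have hroot : ∀ E ∈ ((disc lam ζ q - C c).map (algebraMap ℝ ℂ)).roots,
      E.im = 0 ∧ ‖E‖ ≤ 2 * (1 + lam) := by
    intro E hE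
    have := isRoot_of_mem_roots hE
    rw [IsRoot, eval_map_algebraMap, map_sub, aeval_C, sub_eq_zero] at this
    exact root_disc_sub hlam hq hζ hc this
  have hs : (disc lam ζ q - C c).Splits := by
    refine Splits.of_splits_map_of_injective (algebraMap ℝ ℂ).injective
      (IsAlgClosed.splits _) fun E hE => ?_
    exact ⟨E.re, Complex.ext (by simp) (by simp [(hroot E hE).1])⟩
  refine ⟨(disc lam ζ q - C c).roots.toList, ?_, fun r hr => ?_, ?_⟩
  · rw [Multiset.length_toList, ← hs.natDegree_eq_card_roots, hd]
  · have hr' := isRoot_of_mem_roots (Multiset.mem_toList.1 hr)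
    have h1 : aeval (r : ℂ) (disc lam ζ q) = (c : ℂ) := by
      have h2 : aeval (algebraMap ℝ ℂ r) (disc lam ζ q - C c) = 0 := by
        rw [aeval_algebraMap_apply, coe_aeval_eq_eval, hr', map_zero]
      rw [map_sub, aeval_C, sub_eq_zero] at h2
      exact h2
    have := (root_disc_sub hlam hq hζ hc h1).2
    rwa [Complex.norm_real] at this
  · conv_lhs => rw [hs.eq_prod_roots_of_monic hm]
    conv_lhs => rw [← Multiset.coe_toList (disc lam ζ q - C c).roots]
    rw [Multiset.map_coe, Multiset.prod_coe]

/-- Evaluating at the phase where one hopping term vanishes compares the discriminant with its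
derivative inside the bands. -/
lemma abs_mul_abs_disc_le (hlam : 0 < lam) (hq : 2 ≤ q) (hζ : IsPrimitiveRoot ζ q) {E : ℝ}
    (hE : |E| ≤ 2 * (1 + lam)) (hP : |(disc lam ζ q).eval E| < 2 * (1 + lam ^ q)) :
    |E| * |(disc lam ζ q).eval E| ≤
      6 * (1 + lam) ^ 2 * (q * (1 + lam + lam⁻¹) ^ q * |(derivative (disc lam ζ q)).eval E|) := by
  obtain ⟨y, hy, hpos, hprod⟩ := exists_phase hlam (by omega) hζ
  have hn : ‖ζ‖ = 1 := hζ.norm'_eq_one (by omega)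
  set D := |(derivative (disc lam ζ q)).eval E| with hD
  set c := 1 + lam + lam⁻¹ with hc
  have hli : 0 < lam⁻¹ := inv_pos.2 hlam
  have hper : ∀ k, realWeights lam ζ y (k + q) = realWeights lam ζ y k :=
    realWeights_add_period hζ.pow_eq_one lam y
  have htr : (cocycle E (realWeights lam ζ y) q).trace ^ 2 <
      4 * ∏ k ∈ Finset.range q, realWeights lam ζ y k := by
    have h1 : (cocycle E (realWeights lam ζ y) q).trace = (disc lam ζ q).eval E := by
      rw [disc_eq hq hζ hy]
      have := trace_cocycle_map (evalRingHom E) X (fun k => C (realWeights lam ζ y k)) q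
      simpa using this.symm
    rw [h1, hprod, ← sq_abs]
    have := abs_nonneg ((disc lam ζ q).eval E)
    nlinarith
  have hm : ∀ j < q, ‖continuant (E : ℂ) (weights lam ζ (ζ ^ j * y)) (q - 1)‖ ≤ D := by
    intro j _
    have h1 := abs_continuant_le (by omega) hper hpos htr (j + q - 1)
    rw [← disc_eq hq hζ hy] at h1
    have h2 : (fun k => realWeights lam ζ y (k + (j + q - 1 + 1))) =
        fun k => realWeights lam ζ y (k + j) := by
      funext k
      rw [show k + (j + q - 1 + 1) = k + j + q by omega, hper]
    rw [h2] at h1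
    have h3 := continuant_map Complex.ofRealHom E (fun k => realWeights lam ζ y (k + j)) (q - 1)
    have h4 : weights lam ζ (ζ ^ j * y) = fun k => (realWeights lam ζ y (k + j) : ℂ) := by
      rw [← weights_shift]
      exact funext fun k => weights_eq_ofReal lam hn hy _
    rw [h4]
    simp only [Complex.ofRealHom_eq_coe] at h3
    rw [← h3, Complex.norm_real]
    exact h1
  have hbd : ∀ z : ℂ, ‖z‖ = lam⁻¹ →
      ‖continuant (E : ℂ) (weights lam ζ z) (q - 1)‖ ≤ q * c ^ q * D := by
    intro z hz
    have hz0 : z ≠ 0 := norm_pos_iff.1 (by rw [hz]; exact hli)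
    refine ((laurentBounded_continuant lam (hζ.ne_zero (by omega)) (E : ℂ) (q - 1)).norm_le hζ
      (by omega) hy hm hz0 (c := c) (by rw [hz]; linarith)
      (by rw [hz, inv_inv]; linarith)).trans ?_
    have : 1 ≤ c := by linarith
    gcongr
    omega
  obtain ⟨n, rfl⟩ := Nat.exists_eq_add_of_le' hq
  set z : ℂ := -(lam : ℂ)⁻¹ with hzdef
  have hl0 : (lam : ℂ) ≠ 0 := by exact_mod_cast hlam.ne'
  have hz : ‖z‖ = lam⁻¹ := by
    rw [hzdef, norm_neg, norm_inv, Complex.norm_real, Real.norm_of_nonneg hlam.le]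
  have hz0 : z ≠ 0 := norm_pos_iff.1 (by rw [hz]; exact hli)
  have hb0 : weights lam ζ z 0 = 0 := by
    simp [weights, edge, hzdef, hl0]
  have hbn : weights lam ζ z (n + 2) = 0 := by
    rw [← zero_add (n + 2), weights_add_period hζ.pow_eq_one, hb0]
  have hid : (E : ℂ) * aeval (E : ℂ) (disc lam ζ (n + 2)) =
      E ^ 2 * continuant (E : ℂ) (weights lam ζ (ζ ^ 1 * z)) (n + 1) -
        weights lam ζ z 1 * continuant (E : ℂ) (weights lam ζ (ζ ^ 2 * z)) (n + 1) := by
    rw [aeval_disc hq hζ _ hz0, trace_cocycle, hb0, zero_mul, sub_zero, continuant_add_two',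
      ← weights_shift, ← weights_shift,
      continuant_succ_of_eq_zero (E : ℂ) (fun k => weights lam ζ z (k + 2)) n hbn]
    ring
  have hnE : ‖(E : ℂ)‖ = |E| := by rw [Complex.norm_real, Real.norm_eq_abs]
  have hev : aeval (E : ℂ) (disc lam ζ (n + 2)) = (((disc lam ζ (n + 2)).eval E : ℝ) : ℂ) := by
    have := aeval_algebraMap_apply ℂ E (disc lam ζ (n + 2))
    rwa [coe_aeval_eq_eval] at this
  have hb1 : ‖weights lam ζ z 1‖ ≤ 2 * (1 + lam ^ 2) := by
    have h1 : ‖ζ ^ 1 * z‖ = lam⁻¹ := by rw [norm_mul, norm_pow, hn, hz]; simp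
    rw [weights, edge, norm_mul]
    have h2 : ‖1 + (lam : ℂ) * (ζ ^ 1 * z)‖ ≤ 2 := by
      refine (norm_add_le _ _).trans ?_
      rw [norm_mul, h1, Complex.norm_real, Real.norm_of_nonneg hlam.le, mul_inv_cancel₀ hlam.ne',
        norm_one]
      norm_num
    have h3 : ‖1 + (lam : ℂ) * (ζ ^ 1 * z)⁻¹‖ ≤ 1 + lam ^ 2 := by
      refine (norm_add_le _ _).trans ?_
      rw [norm_mul, norm_inv, h1, Complex.norm_real, Real.norm_of_nonneg hlam.le, inv_inv, norm_one,
        sq]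
    gcongr
  have h1 := congrArg norm hid
  rw [norm_mul, hev, hnE, Complex.norm_real, Real.norm_eq_abs] at h1
  rw [h1]
  have hB : ∀ j : ℕ, ‖continuant (E : ℂ) (weights lam ζ (ζ ^ j * z)) (n + 1)‖ ≤
      (n + 2 : ℕ) * c ^ (n + 2) * D := fun j =>
    hbd _ (by rw [norm_mul, norm_pow, hn, hz]; simp)
  refine (norm_sub_le _ _).trans ?_
  rw [norm_mul, norm_mul, norm_pow, hnE]
  have hE2 : |E| ^ 2 ≤ 4 * (1 + lam) ^ 2 := by nlinarith [abs_nonneg E]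
  have hB1 := hB 1
  have hB2 := hB 2
  have hD0 : 0 ≤ D := abs_nonneg _
  calc _ ≤ 4 * (1 + lam) ^ 2 * ((n + 2 : ℕ) * c ^ (n + 2) * D) +
        2 * (1 + lam ^ 2) * ((n + 2 : ℕ) * c ^ (n + 2) * D) := by gcongr
    _ ≤ _ := by
      rw [← add_mul]
      have : 0 < c := by linarith
      gcongr
      nlinarith

end Discriminant

section Laguerre

variable {R x : ℝ} {l : List ℝ}

/-- A quantitative Laguerre inequality for polynomials with bounded real roots. -/
lemma laguerre (hR : 0 < R) (hx : |x| ≤ R) (hl : ∀ r ∈ l, |r| ≤ R) :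
    l.length / (4 * R ^ 2) * (l.map fun r => X - C r).prod.eval x ^ 2 ≤
      (derivative (l.map fun r => X - C r).prod).eval x ^ 2 -
        (l.map fun r => X - C r).prod.eval x *
          (derivative (derivative (l.map fun r => X - C r).prod)).eval x := by
  induction l with
  | nil => simp
  | cons r l ih =>
    have ih' := ih fun r hr => hl r (List.mem_cons_of_mem _ hr)
    have hr : (x - r) ^ 2 ≤ 4 * R ^ 2 := by
      have h1 := abs_sub x r
      have h2 := hl r List.mem_cons_self
      rw [← sq_abs]
      nlinarith [abs_nonneg (x - r)]
    set Q := (l.map fun r => X - C r).prod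
    simp only [List.map_cons, List.prod_cons, List.length_cons, derivative_mul, derivative_sub,
      derivative_X, derivative_C, sub_zero, one_mul, derivative_add, eval_mul, eval_add, eval_sub,
      eval_X, eval_C]
    change _ * ((x - r) * Q.eval x) ^ 2 ≤ (Q.eval x + (x - r) * Q.derivative.eval x) ^ 2 -
      (x - r) * Q.eval x * (Q.derivative.eval x +
        (Q.derivative.eval x + (x - r) * Q.derivative.derivative.eval x))
    have h1 : 1 / (4 * R ^ 2) * (x - r) ^ 2 ≤ 1 := by
      rw [one_div, inv_mul_le_iff₀ (by positivity), mul_one]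
      exact hr
    have h2 := mul_le_mul_of_nonneg_left ih' (sq_nonneg (x - r))
    have h3 := mul_le_mul_of_nonneg_right h1 (sq_nonneg (Q.eval x))
    have h4 : ((l.length + 1 : ℕ) : ℝ) / (4 * R ^ 2) =
        l.length / (4 * R ^ 2) + 1 / (4 * R ^ 2) := by
      push_cast
      ring
    rw [h4]
    linarith

lemma abs_eval_derivative_derivative_le (hR : 0 ≤ R) (hx : |x| ≤ R) (hl : ∀ r ∈ l, |r| ≤ R) :
    |(derivative (derivative (l.map fun r => X - C r).prod)).eval x| ≤
      (2 * R + 2) ^ l.length := by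
  suffices h : |(l.map fun r => X - C r).prod.eval x| ≤ (2 * R + 2) ^ l.length ∧
      |(derivative (l.map fun r => X - C r).prod).eval x| ≤ (2 * R + 2) ^ l.length ∧
      |(derivative (derivative (l.map fun r => X - C r).prod)).eval x| ≤
        (2 * R + 2) ^ l.length from h.2.2
  induction l with
  | nil => simp
  | cons r l ih =>
    obtain ⟨h0, h1, h2⟩ := ih fun r hr => hl r (List.mem_cons_of_mem _ hr)
    have hr : |x - r| ≤ 2 * R := by
      have h1 := abs_sub x r
      have h2 := hl r List.mem_cons_self
      linarith
    set Q := (l.map fun r => X - C r).prod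
    set A := (2 * R + 2) ^ l.length
    have hA : 0 ≤ A := by positivity
    simp only [List.map_cons, List.prod_cons, List.length_cons, derivative_mul, derivative_sub,
      derivative_X, derivative_C, sub_zero, one_mul, derivative_add, eval_mul, eval_add, eval_sub,
      eval_X, eval_C, pow_succ]
    have hmul : ∀ y, |y| ≤ A → |(x - r) * y| ≤ 2 * R * A := fun y hy => by
      rw [abs_mul]
      gcongr
    have e0 := hmul _ h0
    have e1 := hmul _ h1
    have e2 := hmul _ h2
    refine ⟨by linarith, ?_, ?_⟩
    · refine (abs_add_le _ _).trans ?_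
      linarith
    · refine (abs_add_le _ _).trans ((add_le_add_right (abs_add_le _ _) _).trans ?_)
      linarith

end Laguerre

section Intervals

variable {P : ℝ[X]} {c κ η a b M d m ℓ : ℝ}

lemma sqrt_mul_sub_le_pi (hc : 0 < c) (hab : a < b) (hκ : 0 ≤ κ)
    (hP : ∀ x ∈ Set.Icc a b, |P.eval x| < c)
    (h : ∀ x ∈ Set.Icc a b, κ * (c ^ 2 - P.eval x ^ 2) ≤ P.derivative.eval x ^ 2) :
    √κ * (b - a) ≤ Real.pi := by
  have habs : ∀ x ∈ Set.Icc a b, |P.eval x / c| < 1 := fun x hx => by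
    rw [abs_div, abs_of_pos hc, div_lt_one hc]
    exact hP x hx
  have hder : ∀ x ∈ Set.Icc a b, HasDerivAt (fun x => Real.arcsin (P.eval x / c))
      (1 / √(1 - (P.eval x / c) ^ 2) * (P.derivative.eval x / c)) x := fun x hx => by
    have h1 := abs_lt.1 (habs x hx)
    exact (Real.hasDerivAt_arcsin h1.1.ne' h1.2.ne).comp x ((P.hasDerivAt x).div_const c)
  obtain ⟨ξ, hξ, hξ'⟩ := exists_hasDerivAt_eq_slope _ _ hab
    (fun x hx => (hder x hx).continuousAt.continuousWithinAt)
    (fun x hx => hder x (Set.Ioo_subset_Icc_self hx))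
  have hξI := Set.Ioo_subset_Icc_self hξ
  rw [eq_div_iff (sub_pos.2 hab).ne'] at hξ'
  have hs : 0 < 1 - (P.eval ξ / c) ^ 2 := by
    have := habs ξ hξI
    have := (sq_lt_one_iff_abs_lt_one _).2 this
    linarith
  have hlow : √κ ≤ |1 / √(1 - (P.eval ξ / c) ^ 2) * (P.derivative.eval ξ / c)| := by
    rw [abs_mul, abs_of_pos (by positivity), one_div, inv_mul_eq_div,
      le_div_iff₀ (Real.sqrt_pos.2 hs), ← Real.sqrt_mul hκ, ← Real.sqrt_sq_eq_abs]
    refine Real.sqrt_le_sqrt ?_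
    rw [div_pow, div_pow, one_sub_div (by positivity), ← mul_div_assoc]
    gcongr
    exact h ξ hξI
  have hab' := sub_pos.2 hab
  calc √κ * (b - a) ≤ |1 / √(1 - (P.eval ξ / c) ^ 2) * (P.derivative.eval ξ / c)| * |b - a| := by
        rw [abs_of_pos hab']
        gcongr
    _ = |Real.arcsin (P.eval b / c) - Real.arcsin (P.eval a / c)| := by rw [← abs_mul, hξ']
    _ ≤ Real.pi := by
      have h1 := Real.arcsin_le_pi_div_two (P.eval b / c)
      have h2 := Real.neg_pi_div_two_le_arcsin (P.eval b / c)
      have h3 := Real.arcsin_le_pi_div_two (P.eval a / c)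
      have h4 := Real.neg_pi_div_two_le_arcsin (P.eval a / c)
      rw [abs_le]
      constructor <;> linarith

/-- Log-concavity forces a positive polynomial to oscillate. -/
lemma mul_sq_le_of_log_concave (hℓ : 0 < ℓ) (hc : 0 < c) (hη : 0 ≤ η) (hκ : 0 ≤ κ)
    (hP : ∀ x ∈ Set.Icc a (a + 3 * ℓ), P.eval x ∈ Set.Icc c (c + η))
    (h : ∀ x ∈ Set.Icc a (a + 3 * ℓ), κ * P.eval x ^ 2 ≤
      P.derivative.eval x ^ 2 - P.eval x * P.derivative.derivative.eval x) :
    κ * ℓ ^ 2 ≤ 2 * (η / c) := by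
  have hpos : ∀ x ∈ Set.Icc a (a + 3 * ℓ), 0 < P.eval x := fun x hx => hc.trans_le (hP x hx).1
  have hder : ∀ x ∈ Set.Icc a (a + 3 * ℓ),
      HasDerivAt (fun x => Real.log (P.eval x)) (P.derivative.eval x / P.eval x) x := fun x hx =>
    (P.hasDerivAt x).log (hpos x hx).ne'
  have hder2 : ∀ x ∈ Set.Icc a (a + 3 * ℓ), HasDerivAt (fun x => P.derivative.eval x / P.eval x)
      ((P.derivative.derivative.eval x * P.eval x - P.derivative.eval x * P.derivative.eval x) /
        P.eval x ^ 2) x := fun x hx =>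
    (P.derivative.hasDerivAt x).div (P.hasDerivAt x) (hpos x hx).ne'
  have hmvt : ∀ u ∈ Set.Icc a (a + 2 * ℓ), ∃ ξ ∈ Set.Ioo u (u + ℓ),
      P.derivative.eval ξ / P.eval ξ * ℓ =
        Real.log (P.eval (u + ℓ)) - Real.log (P.eval u) := fun u hu => by
    have hsub : Set.Icc u (u + ℓ) ⊆ Set.Icc a (a + 3 * ℓ) :=
      Set.Icc_subset_Icc hu.1 (by linarith [hu.2])
    obtain ⟨ξ, hξ, hξ'⟩ := exists_hasDerivAt_eq_slope _ _ (show u < u + ℓ by linarith)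
      (fun x hx => (hder x (hsub hx)).continuousAt.continuousWithinAt)
      (fun x hx => hder x (hsub (Set.Ioo_subset_Icc_self hx)))
    refine ⟨ξ, hξ, ?_⟩
    rw [hξ', add_sub_cancel_left, div_mul_cancel₀ _ hℓ.ne']
  obtain ⟨ξ₁, h1, h1'⟩ := hmvt a ⟨le_rfl, by linarith⟩
  obtain ⟨ξ₂, h2, h2'⟩ := hmvt (a + 2 * ℓ) ⟨by linarith, le_rfl⟩
  have hlt : ξ₁ < ξ₂ := by linarith [h1.2, h2.1]
  have hsub : Set.Icc ξ₁ ξ₂ ⊆ Set.Icc a (a + 3 * ℓ) :=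
    Set.Icc_subset_Icc h1.1.le (by linarith [h2.2])
  obtain ⟨ξ, hξ, hξ'⟩ := exists_hasDerivAt_eq_slope _ _ hlt
    (fun x hx => (hder2 x (hsub hx)).continuousAt.continuousWithinAt)
    (fun x hx => hder2 x (hsub (Set.Ioo_subset_Icc_self hx)))
  have hξI := hsub (Set.Ioo_subset_Icc_self hξ)
  have hneg : (P.derivative.derivative.eval ξ * P.eval ξ -
      P.derivative.eval ξ * P.derivative.eval ξ) / P.eval ξ ^ 2 ≤ -κ := by
    have := hpos ξ hξI
    rw [div_le_iff₀ (by positivity)]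
    linarith [h ξ hξI]
  rw [hξ', div_le_iff₀ (sub_pos.2 hlt)] at hneg
  have hlog : ∀ x ∈ Set.Icc a (a + 3 * ℓ), ∀ y ∈ Set.Icc a (a + 3 * ℓ),
      Real.log (P.eval x) - Real.log (P.eval y) ≤ η / c := fun x hx y hy => by
    have h3 := hpos x hx
    have h4 := hpos y hy
    rw [← Real.log_div h3.ne' h4.ne']
    refine (Real.log_le_sub_one_of_pos (by positivity)).trans ?_
    rw [div_sub_one h4.ne']
    have h5 := (hP x hx).2
    have h6 := (hP y hy).1
    gcongr
    linarith
  have h3 := hlog (a + ℓ) ⟨by linarith, by linarith⟩ a ⟨le_rfl, by linarith⟩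
  have h4 := hlog (a + 2 * ℓ) ⟨by linarith, by linarith⟩ (a + 2 * ℓ + ℓ)
    ⟨by linarith, by linarith⟩
  have h5 : κ * ℓ ≤ κ * (ξ₂ - ξ₁) := by
    gcongr
    linarith [h1.2, h2.1]
  have h6 := mul_le_mul_of_nonneg_right (h5.trans (by linarith : κ * (ξ₂ - ξ₁) ≤
    P.derivative.eval ξ₁ / P.eval ξ₁ - P.derivative.eval ξ₂ / P.eval ξ₂)) hℓ.le
  rw [sub_mul, h1', h2'] at h6
  linarith [sq ℓ]

lemma exists_abs_gt_of_abs_derivative_ge (hM : 0 < M) (hd : 0 < d) (hdℓ : d / (2 * M) ≤ ℓ)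
    (hM' : ∀ x, |x - m| ≤ ℓ → |P.derivative.derivative.eval x| ≤ M)
    (hm : |P.eval m| = c) (hm' : d ≤ |P.derivative.eval m|) :
    ∃ x, |x - m| ≤ ℓ ∧ c + d ^ 2 / (4 * M) ≤ |P.eval x| := by
  wlog hpos : P.eval m = c generalizing P
  · have hneg : (-P).eval m = c := by
      rw [eval_neg]
      rcases abs_choice (P.eval m) with h | h
      · exact absurd (h.symm.trans hm) hpos
      · exact h.symm.trans hm
    have := this (P := -P) (by simpa using hM') (by simpa using hm) (by simpa using hm') hneg
    simpa using this
  set τ := d / (2 * M) with hτ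
  have hτ0 : 0 < τ := by positivity
  have hder : ∀ x, |x - m| ≤ τ → |P.derivative.eval x - P.derivative.eval m| ≤ d / 2 := by
    intro x hx
    have := (convex_Icc (m - τ) (m + τ)).norm_image_sub_le_of_norm_hasDerivWithin_le
      (f := fun x => P.derivative.eval x) (C := M) (x := m) (y := x)
      (fun x _ => (P.derivative.hasDerivAt x).hasDerivWithinAt)
      (fun y hy => hM' y ((abs_le.2 ⟨by linarith [hy.1], by linarith [hy.2]⟩).trans hdℓ))
      ⟨by linarith, by linarith⟩
      ⟨by linarith [(abs_le.1 hx).1], by linarith [(abs_le.1 hx).2]⟩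
    refine this.trans ?_
    rw [Real.norm_eq_abs]
    calc M * |x - m| ≤ M * τ := by gcongr
      _ = d / 2 := by rw [hτ]; field_simp
  have hfin : d ^ 2 / (4 * M) = d / 2 * τ := by rw [hτ]; field_simp; ring
  have hmono : ∀ y, |y - m| ≤ τ → y = m - τ ∨ y = m + τ → P.eval m + d / 2 * τ ≤ P.eval y →
      ∃ x, |x - m| ≤ ℓ ∧ c + d ^ 2 / (4 * M) ≤ |P.eval x| := fun y hy _ hle =>
    ⟨y, hy.trans hdℓ, by rw [hfin, ← hpos]; exact hle.trans (le_abs_self _)⟩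
  rcases le_abs.1 hm' with hp | hn
  · refine hmono (m + τ) (by rw [add_sub_cancel_left, abs_of_pos hτ0]) (Or.inr rfl) ?_
    obtain ⟨ξ, hξ, hξ'⟩ := exists_hasDerivAt_eq_slope (fun x => P.eval x) _
      (show m < m + τ by linarith) P.continuous.continuousOn (fun x _ => P.hasDerivAt x)
    rw [add_sub_cancel_left, eq_div_iff hτ0.ne'] at hξ'
    have := abs_le.1 (hder ξ (abs_le.2 ⟨by linarith [hξ.1], by linarith [hξ.2]⟩))
    have := mul_le_mul_of_nonneg_right (show d / 2 ≤ P.derivative.eval ξ by linarith) hτ0.le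
    linarith
  · refine hmono (m - τ) (by rw [sub_sub_cancel_left, abs_neg, abs_of_pos hτ0]) (Or.inl rfl) ?_
    obtain ⟨ξ, hξ, hξ'⟩ := exists_hasDerivAt_eq_slope (fun x => P.eval x) _
      (show m - τ < m by linarith) P.continuous.continuousOn (fun x _ => P.hasDerivAt x)
    rw [sub_sub_cancel, eq_div_iff hτ0.ne'] at hξ'
    have := abs_le.1 (hder ξ (abs_le.2 ⟨by linarith [hξ.1], by linarith [hξ.2]⟩))
    have := mul_le_mul_of_nonneg_right (show d / 2 ≤ -P.derivative.eval ξ by linarith) hτ0.le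
    linarith

/-- A polynomial with real, bounded `±c`-level sets cannot stay close to `[-c, c]` on an
interval. -/
lemma exists_abs_gt (hc : 0 < c) (hη : 0 ≤ η) (hκ : 0 < κ) (hM : 0 < M) (hd : 0 < d)
    (hℓ : 0 < ℓ) (hdℓ : d / (2 * M) ≤ ℓ) (hπ : Real.pi < √κ * (2 * ℓ))
    (hκη : 2 * (η / (2 * c)) < κ * (2 * ℓ / 3) ^ 2) (hdη : η < d ^ 2 / (4 * M))
    (hlag : ∀ x, |x - m| ≤ 2 * ℓ → ∀ s, |s| = c → κ * (P.eval x - s) ^ 2 ≤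
      P.derivative.eval x ^ 2 - (P.eval x - s) * P.derivative.derivative.eval x)
    (hder : ∀ x, |x - m| ≤ 2 * ℓ → |P.eval x| < c →
      d * |P.eval x| ≤ c * |P.derivative.eval x|)
    (hM' : ∀ x, |x - m| ≤ 2 * ℓ → |P.derivative.derivative.eval x| ≤ M) :
    ∃ x, |x - m| ≤ 2 * ℓ ∧ c + η < |P.eval x| := by
  by_contra! hcon
  have hcont : Continuous fun x => |P.eval x| := P.continuous.abs
  have hmem : ∀ x ∈ Set.Icc (m - ℓ) (m + ℓ), |x - m| ≤ ℓ := fun x hx =>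
    abs_le.2 ⟨by linarith [hx.1], by linarith [hx.2]⟩
  have hmem' : ∀ x ∈ Set.Icc (m - ℓ) (m + ℓ), |x - m| ≤ 2 * ℓ := fun x hx =>
    (hmem x hx).trans (by linarith)
  by_cases hin : ∀ x ∈ Set.Icc (m - ℓ) (m + ℓ), |P.eval x| < c
  · have := sqrt_mul_sub_le_pi hc (show m - ℓ < m + ℓ by linarith) hκ.le hin fun x hx => by
      have hx' := hmem' x hx
      have h1 := hlag x hx' c (abs_of_pos hc)
      have h2 := hlag x hx' (-c) (by rw [abs_neg, abs_of_pos hc])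
      have h3 := abs_lt.1 (hin x hx)
      have h4 := mul_le_mul_of_nonneg_left h1 (show 0 ≤ c + P.eval x by linarith)
      have h5 := mul_le_mul_of_nonneg_left h2 (show 0 ≤ c - P.eval x by linarith)
      have h6 : 2 * c * (κ * (c ^ 2 - P.eval x ^ 2)) ≤ 2 * c * P.derivative.eval x ^ 2 := by
        linear_combination h4 + h5
      exact le_of_mul_le_mul_left h6 (by positivity)
    linarith [show √κ * (m + ℓ - (m - ℓ)) = √κ * (2 * ℓ) by ring]
  push Not at hin
  by_cases hout : ∀ x ∈ Set.Icc (m - ℓ) (m + ℓ), c ≤ |P.eval x|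
  · have hI : Set.Icc (m - ℓ) (m - ℓ + 3 * (2 * ℓ / 3)) = Set.Icc (m - ℓ) (m + ℓ) := by
      congr 1
      ring
    have key : ∀ Q : ℝ[X], (Q = P ∨ Q = -P) → (∀ x ∈ Set.Icc (m - ℓ) (m + ℓ), c ≤ Q.eval x) →
        False := fun Q hQ hQc => by
      have hQabs : ∀ x, |Q.eval x| = |P.eval x| := fun x => by
        rcases hQ with rfl | rfl <;> simp
      have := mul_sq_le_of_log_concave (P := Q + C c) (a := m - ℓ) (ℓ := 2 * ℓ / 3) (c := 2 * c)
        (η := η) (κ := κ) (by positivity) (by positivity) hη hκ.le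
        (by
          rw [hI]
          intro x hx
          rw [eval_add, eval_C]
          have h1 := hcon x (hmem' x hx)
          rw [← hQabs] at h1
          exact ⟨by linarith [hQc x hx], by linarith [le_abs_self (Q.eval x)]⟩)
        (by
          rw [hI]
          intro x hx
          rcases hQ with rfl | rfl
          · have := hlag x (hmem' x hx) (-c) (by rw [abs_neg, abs_of_pos hc])
            simpa using this
          · have := hlag x (hmem' x hx) c (abs_of_pos hc)
            simp only [derivative_add, derivative_C, add_zero, derivative_neg, eval_neg, eval_add,
              eval_C]
            linarith)
      linarith
    by_cases hs : ∃ x ∈ Set.Icc (m - ℓ) (m + ℓ), 0 < P.eval x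
    · refine key P (Or.inl rfl) fun y hy => ?_
      by_contra! hy'
      obtain ⟨x, hx, hx'⟩ := hs
      have hy0 : P.eval y < 0 := by
        rcases le_abs.1 (hout y hy) with h | h <;> linarith
      obtain ⟨z, hz, hz'⟩ := isPreconnected_Icc.intermediate_value hy hx P.continuous.continuousOn
        ⟨hy0.le, hx'.le⟩
      have := hout z hz
      rw [show P.eval z = 0 from hz', abs_zero] at this
      linarith
    · push Not at hs
      refine key (-P) (Or.inr rfl) fun y hy => ?_
      have := hout y hy
      rwa [abs_of_nonpos (hs y hy), ← eval_neg] at this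
  push Not at hout
  obtain ⟨x₁, hx₁, hx₁'⟩ := hin
  obtain ⟨x₂, hx₂, hx₂'⟩ := hout
  have hopen : IsOpen {x | |P.eval x| < c} := isOpen_lt hcont continuous_const
  obtain ⟨E, hE, hEcl, hEt⟩ : ∃ E ∈ Set.Icc (m - ℓ) (m + ℓ),
      E ∈ closure {x | |P.eval x| < c} \ {x | |P.eval x| < c} := by
    by_contra! hno
    have hno' : ∀ x ∈ Set.Icc (m - ℓ) (m + ℓ), x ∈ closure {x | |P.eval x| < c} →
        x ∈ {x | |P.eval x| < c} := fun x hx hxc => by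
      by_contra hxt
      exact hno x hx ⟨hxc, hxt⟩
    obtain ⟨x, -, hx, hx'⟩ := isPreconnected_Icc _ _ hopen
      (isClosed_closure (s := {x | |P.eval x| < c})).isOpen_compl
      (fun x hx => or_iff_not_imp_right.2 fun h => hno' x hx (not_not.1 h))
      ⟨x₂, hx₂, hx₂'⟩ ⟨x₁, hx₁, fun h => absurd (hno' x₁ hx₁ h) (not_lt.2 hx₁')⟩
    exact hx' (subset_closure hx)
  have hEc : |P.eval E| = c := by
    refine le_antisymm ?_ (not_lt.1 hEt)
    exact closure_minimal (s := {x | |P.eval x| < c}) (t := {x | |P.eval x| ≤ c})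
      (fun x hx => le_of_lt (show |P.eval x| < c from hx)) (isClosed_le hcont continuous_const) hEcl
  have hEd : d ≤ |P.derivative.eval E| := by
    have hball : Metric.ball E ℓ ∈ nhds E := Metric.ball_mem_nhds E hℓ
    have h1 : E ∈ closure ({x | |P.eval x| < c} ∩ Metric.ball E ℓ) := by
      refine mem_closure_iff_nhds.2 fun t ht => ?_
      obtain ⟨x, hx, hx'⟩ := mem_closure_iff_nhds.1 hEcl _ (Filter.inter_mem ht hball)
      exact ⟨x, hx.1, hx', hx.2⟩
    have h2 := closure_minimal (t := {x | d * |P.eval x| ≤ c * |P.derivative.eval x|})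
      (fun x hx => hder x (by
        have h3 := Metric.mem_ball.1 hx.2
        rw [Real.dist_eq] at h3
        have h4 := abs_add_le (x - E) (E - m)
        rw [sub_add_sub_cancel] at h4
        linarith [hmem E hE]) hx.1)
      (isClosed_le (continuous_const.mul hcont) (continuous_const.mul P.derivative.continuous.abs))
      h1
    simp only [Set.mem_ofPred_eq, hEc] at h2
    rw [mul_comm] at h2
    exact le_of_mul_le_mul_left h2 hc
  have htri : ∀ x, |x - E| ≤ ℓ → |x - m| ≤ 2 * ℓ := fun x hx => by
    have h4 := abs_add_le (x - E) (E - m)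
    rw [sub_add_sub_cancel] at h4
    linarith [hmem E hE]
  obtain ⟨x, hx, hx'⟩ := exists_abs_gt_of_abs_derivative_ge hM hd hdℓ
    (fun x hx => hM' x (htri x hx)) hEc hEd
  linarith [hcon x (htri x hx)]

end Intervals

lemma exists_disc_gt {lam m ℓ e : ℝ} (hlam : 0 < lam) (hℓ : 0 < ℓ) (he : 0 < e)
    (hI : ∀ x, |x - m| ≤ 2 * ℓ → |x| ≤ 2 * (1 + lam) ∧ e ≤ |x|) :
    ∃ N : ℕ, ∃ B : ℝ, 0 < B ∧ ∀ q : ℕ, N ≤ q → 2 ≤ q → ∀ ζ : ℂ, IsPrimitiveRoot ζ q →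
      ∀ η : ℝ, 0 ≤ η → η * B ^ q ≤ 1 →
        ∃ x, |x - m| ≤ 2 * ℓ ∧ 2 * (1 + lam ^ q) + η < |(disc lam ζ q).eval x| := by
  set R := 2 * (1 + lam) with hR
  set A := 2 * R + 2 with hA
  set γ := 1 + lam + lam⁻¹ with hγ
  have hli : 0 < lam⁻¹ := inv_pos.2 hlam
  have hR0 : 0 < R := by positivity
  have hA1 : 1 ≤ A := by linarith
  have hγ1 : 1 ≤ γ := by linarith
  obtain ⟨N, hN⟩ := exists_nat_gt
    (max (e / ℓ) (max (36 * (1 + lam) ^ 4 / e ^ 2) (16 * R ^ 2 / ℓ ^ 2)))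
  refine ⟨N, 8 * γ ^ 2 * A, by positivity, fun q hNq hq ζ hζ η hη hηB => ?_⟩
  have hNq' : (N : ℝ) ≤ q := by exact_mod_cast hNq
  have hq1 := ((le_max_left _ _).trans_lt hN).trans_le hNq'
  have hq2 := (((le_max_left _ _).trans (le_max_right _ _)).trans_lt hN).trans_le hNq'
  have hq3 := (((le_max_right _ _).trans (le_max_right _ _)).trans_lt hN).trans_le hNq'
  have hq0 : (0 : ℝ) < q := by exact_mod_cast (by omega : 0 < q)
  rw [div_lt_iff₀ (by positivity)] at hq1 hq2 hq3
  set K := 6 * (1 + lam) ^ 2 * (q * γ ^ q) with hK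
  have hγq : 1 ≤ γ ^ q := one_le_pow₀ hγ1
  have hAq : 1 ≤ A ^ q := one_le_pow₀ hA1
  have hKq : q ≤ K := by
    have h1 : 1 ≤ 6 * (1 + lam) ^ 2 := by nlinarith
    have h2 : (q : ℝ) ≤ q * γ ^ q := le_mul_of_one_le_right hq0.le hγq
    calc (q : ℝ) ≤ q * γ ^ q := h2
      _ ≤ K := le_mul_of_one_le_left (by positivity) h1
  have hK0 : 0 < K := hq0.trans_le hKq
  set c := 2 * (1 + lam ^ q) with hc
  have hc2 : 2 ≤ c := by have := pow_pos hlam q; linarith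
  have hκ : 4 / ℓ ^ 2 < q / (4 * R ^ 2) := by
    rw [div_lt_div_iff₀ (by positivity) (by positivity)]
    linarith
  have hκ0 : 0 < q / (4 * R ^ 2) := by positivity
  have hη1 : η ≤ 1 := by
    refine le_trans (le_mul_of_one_le_right hη (one_le_pow₀ ?_)) hηB
    have : 1 ≤ γ ^ 2 := one_le_pow₀ hγ1
    nlinarith
  have hsmall : η * (K ^ 2 * A ^ q) < e ^ 2 := by
    have h2q : (q : ℝ) < 2 ^ q := by exact_mod_cast Nat.lt_two_pow_self
    have hq4 : (q : ℝ) ^ 2 ≤ 4 ^ q := by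
      calc (q : ℝ) ^ 2 ≤ (2 ^ q) ^ 2 := by gcongr
        _ = 4 ^ q := by rw [← pow_mul, mul_comm, pow_mul]; norm_num
    have h1 : η * (K ^ 2 * A ^ q) * 2 ^ q ≤ 36 * (1 + lam) ^ 4 := by
      calc η * (K ^ 2 * A ^ q) * 2 ^ q
          = 36 * (1 + lam) ^ 4 * (η * ((q : ℝ) ^ 2 * (γ ^ 2) ^ q * A ^ q * 2 ^ q)) := by
            rw [hK, ← pow_mul, mul_comm 2 q, pow_mul]; ring
        _ ≤ 36 * (1 + lam) ^ 4 * (η * (4 ^ q * (γ ^ 2) ^ q * A ^ q * 2 ^ q)) := by gcongr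
        _ = 36 * (1 + lam) ^ 4 * (η * (8 * γ ^ 2 * A) ^ q) := by
            rw [show (8 : ℝ) = 4 * 2 by norm_num]
            simp only [mul_pow]
            ring
        _ ≤ 36 * (1 + lam) ^ 4 * 1 := by gcongr
        _ = _ := mul_one _
    have h2 : 36 * (1 + lam) ^ 4 < e ^ 2 * 2 ^ q := by
      have := mul_lt_mul_of_pos_left h2q (pow_pos he 2)
      linarith
    exact lt_of_mul_lt_mul_right (h1.trans_lt h2) (by positivity)
  refine exists_abs_gt (κ := q / (4 * R ^ 2)) (M := A ^ q) (d := 2 * e / K) (by linarith) hη hκ0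
    (by positivity) (by positivity) hℓ ?_ ?_ ?_ ?_ ?_ ?_ ?_
  · rw [div_le_iff₀ (by positivity), div_le_iff₀ hK0]
    have h1 : q * ℓ ≤ K * ℓ := by gcongr
    have h2 : K * ℓ ≤ A ^ q * (K * ℓ) := le_mul_of_one_le_left (by positivity) hAq
    linarith
  · have h1 : 2 / ℓ < √(q / (4 * R ^ 2)) := by
      rw [Real.lt_sqrt (by positivity), div_pow]
      norm_num
      exact hκ
    have h2 := mul_lt_mul_of_pos_right h1 (show 0 < 2 * ℓ by positivity)
    rw [show 2 / ℓ * (2 * ℓ) = 4 by field_simp; norm_num] at h2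
    linarith [Real.pi_lt_four]
  · have h1 := mul_lt_mul_of_pos_right hκ (show 0 < (2 * ℓ / 3) ^ 2 by positivity)
    rw [show 4 / ℓ ^ 2 * (2 * ℓ / 3) ^ 2 = 16 / 9 by field_simp; norm_num] at h1
    have h2 : η / (2 * c) ≤ 1 / 4 := by
      rw [div_le_div_iff₀ (by positivity) (by norm_num)]
      linarith
    linarith
  · rw [lt_div_iff₀ (by positivity), div_pow, lt_div_iff₀ (by positivity)]
    linarith
  · intro x hx s hs
    obtain ⟨l, hl, hlR, hls⟩ := exists_list_disc_sub hlam hq hζ hs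
    have := laguerre hR0 (hI x hx).1 hlR
    rw [← hls, hl] at this
    simpa using this
  · intro x hx hxc
    have h1 := abs_mul_abs_disc_le hlam hq hζ (hI x hx).1 hxc
    rw [div_mul_eq_mul_div, div_le_iff₀ hK0]
    have h2 := mul_le_mul_of_nonneg_right (hI x hx).2 (abs_nonneg ((disc lam ζ q).eval x))
    have h3 := mul_le_mul_of_nonneg_right hc2
      (show 0 ≤ K * |(derivative (disc lam ζ q)).eval x| by positivity)
    rw [← mul_assoc (6 * (1 + lam) ^ 2)] at h1
    linarith
  · intro x hx
    obtain ⟨l, hl, hlR, hls⟩ := exists_list_disc_sub hlam hq hζ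
      (c := c) (abs_of_pos (by linarith))
    have := abs_eval_derivative_derivative_le hR0.le (hI x hx).1 hlR
    rw [← hls, hl] at this
    simpa using this

section Exactness

/-- The periodic Jacobi operator with hopping amplitudes `1 + lam * (ζ ^ k * y)`. -/
noncomputable def jacobi (lam : ℝ) (ζ y : ℂ) : Module.End ℂ (ℤ →₀ ℂ) :=
  Finsupp.linearCombination ℂ fun k : ℤ =>
    Finsupp.single (k + 1) (1 + lam * (ζ ^ k * y)) +
      Finsupp.single (k - 1) (1 + lam * (ζ ^ (k - 1) * y)⁻¹)

/-- Multiplication by `u + u⁻¹ + lam (u w + w⁻¹ u⁻¹)` in the algebra generated by `u` and `w`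
with `w u = z u w`, in the basis of the monomials `u ^ k w ^ j`. -/
noncomputable def formalOp (lam : ℝ) (z : ℂ) : Module.End ℂ (ℤ × ℤ →₀ ℂ) :=
  Finsupp.linearCombination ℂ fun p : ℤ × ℤ =>
    Finsupp.single (p.1 + 1, p.2) 1 + Finsupp.single (p.1 + 1, p.2 + 1) (lam * z ^ p.1) +
      (Finsupp.single (p.1 - 1, p.2) 1 +
        Finsupp.single (p.1 - 1, p.2 - 1) (lam * (z ^ (p.1 - 1))⁻¹))

/-- Specialisation of `w` to the scalar `y`. -/
noncomputable def specialize (y : ℂ) : (ℤ × ℤ →₀ ℂ) →ₗ[ℂ] (ℤ →₀ ℂ) :=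
  Finsupp.linearCombination ℂ fun p : ℤ × ℤ => Finsupp.single p.1 (y ^ p.2)

variable {lam : ℝ} {ζ y : ℂ} {q : ℕ}

lemma jacobi_single (lam : ℝ) (ζ y : ℂ) (k : ℤ) (c : ℂ) :
    jacobi lam ζ y (Finsupp.single k c) =
      c • (Finsupp.single (k + 1) (1 + lam * (ζ ^ k * y)) +
        Finsupp.single (k - 1) (1 + lam * (ζ ^ (k - 1) * y)⁻¹)) := by
  rw [jacobi, Finsupp.linearCombination_single]

lemma formalOp_single (lam : ℝ) (z : ℂ) (p : ℤ × ℤ) (c : ℂ) :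
    formalOp lam z (Finsupp.single p c) =
      c • (Finsupp.single (p.1 + 1, p.2) 1 + Finsupp.single (p.1 + 1, p.2 + 1) (lam * z ^ p.1) +
        (Finsupp.single (p.1 - 1, p.2) 1 +
          Finsupp.single (p.1 - 1, p.2 - 1) (lam * (z ^ (p.1 - 1))⁻¹))) := by
  rw [formalOp, Finsupp.linearCombination_single]

lemma specialize_single (y : ℂ) (p : ℤ × ℤ) (c : ℂ) :
    specialize y (Finsupp.single p c) = Finsupp.single p.1 (c * y ^ p.2) := by
  rw [specialize, Finsupp.linearCombination_single, Finsupp.smul_single, smul_eq_mul]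

lemma specialize_formalOp (hy : y ≠ 0) (x : ℤ × ℤ →₀ ℂ) :
    specialize y (formalOp lam ζ x) = jacobi lam ζ y (specialize y x) := by
  induction x using Finsupp.induction_linear with
  | zero => simp
  | add a b ha hb => simp only [map_add, ha, hb]
  | single p c =>
    simp only [formalOp_single, specialize_single, jacobi_single, map_smul, map_add, one_mul]
    rw [← smul_smul]
    congr 1
    simp only [← Finsupp.single_add, smul_add, Finsupp.smul_single, smul_eq_mul]
    congr 2
    · rw [zpow_add_one₀ hy]
      ring
    · rw [zpow_sub_one₀ hy, mul_inv]
      ring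

lemma specialize_aeval (hy : y ≠ 0) (p : ℂ[X]) (x : ℤ × ℤ →₀ ℂ) :
    specialize y (aeval (formalOp lam ζ) p x) = aeval (jacobi lam ζ y) p (specialize y x) := by
  induction p using Polynomial.induction_on' with
  | add p r hp hr => simp only [map_add, LinearMap.add_apply, hp, hr]
  | monomial n a =>
    simp only [aeval_monomial, Module.End.mul_apply, Module.algebraMap_end_apply, map_smul]
    congr 1
    induction n with
    | zero => simp
    | succ n ih => rw [pow_succ', pow_succ', Module.End.mul_apply, Module.End.mul_apply,
        specialize_formalOp hy, ih]

lemma aeval_jacobi_disc (hq : 2 ≤ q) (hζ : IsPrimitiveRoot ζ q) (hy : y ≠ 0)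
    (hB : 1 - (-(lam : ℂ)) ^ q * y ^ q ≠ 0) :
    aeval (jacobi lam ζ y) ((disc lam ζ q).map (algebraMap ℝ ℂ)) (Finsupp.single 0 1) =
      Finsupp.single (q : ℤ) (1 - (-(lam : ℂ)) ^ q * y ^ q) +
        Finsupp.single (-q : ℤ) (1 - (-(lam : ℂ)) ^ q * (y ^ q)⁻¹) := by
  have hζ0 : ζ ≠ 0 := hζ.ne_zero (by omega)
  have hζq : ζ ^ (q : ℤ) = 1 := by rw [zpow_natCast, hζ.pow_eq_one]
  set J := jacobi lam ζ y
  set g : ℕ → (ℤ →₀ ℂ) := fun k =>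
    Finsupp.single (k - q : ℤ) (∏ j ∈ Finset.range k, (1 + lam * (ζ ^ j * y))) with hg
  set T : ℕ → Matrix (Fin 2) (Fin 2) ℂ[X] := fun k =>
    cocycle (X : ℂ[X]) (fun k => C (weights lam ζ y k)) k with hT
  have hrec : ∀ k, g (k + 2) = J (g (k + 1)) - weights lam ζ y k • g k := by
    intro k
    simp only [hg, J, jacobi_single, weights, edge]
    have h1 : ζ ^ (((k + 1 : ℕ) : ℤ) - q) = ζ ^ (k + 1) := by
      rw [zpow_sub₀ hζ0, hζq, div_one, zpow_natCast]
    have h2 : ζ ^ (((k + 1 : ℕ) : ℤ) - q - 1) = ζ ^ k := by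
      rw [zpow_sub_one₀ hζ0, h1, pow_succ, mul_assoc, mul_inv_cancel₀ hζ0, mul_one]
    have h3 : ((k + 1 : ℕ) : ℤ) - q + 1 = ((k + 2 : ℕ) : ℤ) - q := by push_cast; ring
    have h4 : ((k + 1 : ℕ) : ℤ) - q - 1 = (k : ℤ) - q := by push_cast; ring
    rw [h2, h1, h3, h4, smul_add, Finsupp.smul_single, Finsupp.smul_single, Finsupp.smul_single,
      eq_sub_iff_add_eq, smul_eq_mul, smul_eq_mul, smul_eq_mul, ← Finset.prod_range_succ]
    congr 2
    rw [Finset.prod_range_succ]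
    ring
  have hact : ∀ k, g (k + 1) = aeval J (T k 0 0) (g 1) + aeval J (T k 0 1) (g 0) ∧
      g k = aeval J (T k 1 0) (g 1) + aeval J (T k 1 1) (g 0) := by
    intro k
    induction k with
    | zero => simp [hT, cocycle_zero]
    | succ k ih =>
      have hs : ∀ j, T (k + 1) 0 j = X * T k 0 j - C (weights lam ζ y k) * T k 1 j ∧
          T (k + 1) 1 j = T k 0 j := fun j => by
        simp only [hT, cocycle_succ, Matrix.mul_apply, Fin.sum_univ_two, transfer]
        constructor <;> simp [sub_eq_add_neg]
      rw [(hs 0).1, (hs 1).1, (hs 0).2, (hs 1).2]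
      refine ⟨?_, ih.1⟩
      rw [hrec]
      conv_lhs => rw [ih.1, ih.2]
      simp only [map_sub, map_mul, aeval_X, aeval_C, map_add, LinearMap.sub_apply,
        Module.End.mul_apply, Module.algebraMap_end_apply, smul_add]
      abel
  have hper : ∀ k, C (weights lam ζ y (k + q)) = C (weights lam ζ y k) := fun k => by
    rw [weights_add_period hζ.pow_eq_one]
  have htwo := cocycle_two_mul (X : ℂ[X]) (fun k => C (weights lam ζ y k)) q hper
  rw [← map_disc hq hζ hy, ← map_prod] at htwo
  have hfin : g (q + q) = aeval J ((disc lam ζ q).map (algebraMap ℝ ℂ)) (g q) -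
      (∏ k ∈ Finset.range q, weights lam ζ y k) • g 0 := by
    rw [(hact (q + q)).2, (hact q).2]
    simp only [hT, htwo]
    simp only [Matrix.sub_apply, Matrix.smul_apply, smul_eq_mul, map_sub, map_mul, aeval_C,
      LinearMap.sub_apply, Module.End.mul_apply, Module.algebraMap_end_apply, map_add]
    simp
    abel
  have hB1 := prod_hop (by omega) hζ lam y
  have hB2 : ∏ k ∈ Finset.range (q + q), (1 + lam * (ζ ^ k * y)) =
      (1 - (-(lam : ℂ)) ^ q * y ^ q) * (1 - (-(lam : ℂ)) ^ q * y ^ q) := by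
    rw [Finset.prod_range_add, hB1]
    simp only [pow_add, hζ.pow_eq_one, one_mul]
    rw [hB1]
  simp only [hg, hB1, hB2, prod_weights (by omega : 0 < q) hζ, sub_self, Finset.prod_range_zero,
    Nat.cast_add, add_sub_cancel_right, Nat.cast_zero, zero_sub] at hfin
  have hsingle : Finsupp.single (0 : ℤ) (1 - (-(lam : ℂ)) ^ q * y ^ q) =
      (1 - (-(lam : ℂ)) ^ q * y ^ q) • Finsupp.single (0 : ℤ) (1 : ℂ) := by simp
  rw [hsingle, map_smul, eq_sub_iff_add_eq] at hfin
  refine smul_right_injective _ hB (hfin.symm.trans ?_)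
  simp only [smul_add, Finsupp.smul_single, smul_eq_mul, mul_one]

lemma eq_zero_of_specialize_eq_zero {r : ℝ} {x : ℤ × ℤ →₀ ℂ}
    (h : ∀ y : ℂ, r < ‖y‖ → specialize y x = 0) : x = 0 := by
  have hcoef : ∀ (y : ℂ) (x : ℤ × ℤ →₀ ℂ) (k : ℤ),
      specialize y x k = (x.curry k).sum fun j c => c * y ^ j := by
    intro y x k
    induction x using Finsupp.induction_linear with
    | zero =>
      have h0 : (0 : ℤ × ℤ →₀ ℂ).curry = 0 := by ext; simp
      simp [h0]
    | add a b ha hb =>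
      have hab : (a + b).curry = a.curry + b.curry := by ext; simp
      rw [map_add, Finsupp.add_apply, ha, hb, hab, Finsupp.add_apply,
        Finsupp.sum_add_index' (by simp) (by intros; ring)]
    | single p c =>
      rw [specialize_single, Finsupp.curry_single]
      by_cases hk : p.1 = k
      · subst hk
        simp
      · simp [hk]
  have hone : ∀ f : ℤ →₀ ℂ, (∀ y : ℂ, r < ‖y‖ → (f.sum fun j c => c * y ^ j) = 0) → f = 0 := by
    intro f hf
    obtain ⟨N, hN⟩ : ∃ N : ℕ, ∀ j ∈ f.support, 0 ≤ j + N := by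
      refine ⟨∑ j ∈ f.support, j.natAbs, fun j hj => ?_⟩
      have := Finset.single_le_sum (f := fun j : ℤ => j.natAbs) (fun _ _ => Nat.zero_le _) hj
      omega
    set p : ℂ[X] := ∑ j ∈ f.support, C (f j) * X ^ (j + N).toNat with hp
    have hp0 : p = 0 := by
      refine eq_zero_of_infinite_isRoot p (Set.Infinite.mono (s := Set.range fun n : ℕ =>
        (((n : ℝ) + |r| + 1 : ℝ) : ℂ)) ?_ (Set.infinite_range_of_injective fun m n hmn => ?_))
      · rintro _ ⟨n, rfl⟩
        have hn : (0 : ℝ) < (n : ℝ) + |r| + 1 := by positivity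
        set y : ℂ := (((n : ℝ) + |r| + 1 : ℝ) : ℂ) with hy
        have hny : ‖y‖ = (n : ℝ) + |r| + 1 := by rw [hy, Complex.norm_real, Real.norm_of_nonneg hn.le]
        have hy0 : y ≠ 0 := norm_pos_iff.1 (by rw [hny]; exact hn)
        have hr : r < ‖y‖ := by
          rw [hny]
          have := le_abs_self r
          have : (0 : ℝ) ≤ n := n.cast_nonneg
          linarith
        have h1 := hf y hr
        change p.eval y = 0
        rw [hp, eval_finsetSum]
        rw [Finsupp.sum] at h1
        calc ∑ j ∈ f.support, (C (f j) * X ^ (j + N).toNat).eval y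
            = ∑ j ∈ f.support, y ^ N * (f j * y ^ j) := Finset.sum_congr rfl fun j hj => by
              have h2 : y ^ (j + N).toNat = y ^ j * y ^ N := by
                rw [← zpow_natCast, Int.toNat_of_nonneg (hN j hj), zpow_add₀ hy0, zpow_natCast]
              simp only [eval_mul, eval_C, eval_pow, eval_X, h2]
              ring
          _ = 0 := by rw [← Finset.mul_sum, h1, mul_zero]
      · simpa using hmn
    ext j
    by_contra hj
    have hj' : j ∈ f.support := Finsupp.mem_support_iff.2 hj
    have h1 : p.coeff (j + N).toNat = f j := by
      rw [hp, finsetSum_coeff, Finset.sum_eq_single j]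
      · simp
      · intro i hi hij
        rw [coeff_C_mul, coeff_X_pow, if_neg, mul_zero]
        have := hN i hi
        have := hN j hj'
        omega
      · exact fun h => absurd hj' h
    rw [hp0, coeff_zero] at h1
    exact hj h1.symm
  ext ⟨k, j⟩
  have := hone (x.curry k) fun y hy => by rw [← hcoef, h y hy, Finsupp.zero_apply]
  have := DFunLike.congr_fun this j
  simpa using this

lemma aeval_formalOp_disc (hlam : 0 < lam) (hq : 2 ≤ q) (hζ : IsPrimitiveRoot ζ q) :
    aeval (formalOp lam ζ) ((disc lam ζ q).map (algebraMap ℝ ℂ)) (Finsupp.single (0, 0) 1) =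
      Finsupp.single ((q : ℤ), (0 : ℤ)) 1 +
          Finsupp.single ((q : ℤ), (q : ℤ)) (-(-(lam : ℂ)) ^ q) +
        (Finsupp.single (-(q : ℤ), (0 : ℤ)) 1 +
          Finsupp.single (-(q : ℤ), -(q : ℤ)) (-(-(lam : ℂ)) ^ q)) := by
  refine sub_eq_zero.1 (eq_zero_of_specialize_eq_zero (r := lam⁻¹) fun y hy => ?_)
  have hli : 0 < lam⁻¹ := inv_pos.2 hlam
  have hy0 : y ≠ 0 := norm_pos_iff.1 (hli.trans hy)
  have hB : 1 - (-(lam : ℂ)) ^ q * y ^ q ≠ 0 := by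
    intro h0
    have h1 : ‖(-(lam : ℂ)) ^ q * y ^ q‖ = 1 := by rw [← sub_eq_zero.1 h0, norm_one]
    rw [norm_mul, norm_pow, norm_pow, norm_neg, Complex.norm_real, Real.norm_of_nonneg hlam.le,
      ← mul_pow] at h1
    have h2 : 1 < lam * ‖y‖ := by
      rwa [inv_lt_iff_one_lt_mul₀' hlam] at hy
    have := one_lt_pow₀ h2 (by omega : q ≠ 0)
    linarith
  rw [map_sub, specialize_aeval hy0, sub_eq_zero]
  simp only [map_add, specialize_single, zpow_zero, mul_one, _root_.zpow_neg, zpow_natCast]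
  rw [aeval_jacobi_disc hq hζ hy0 hB]
  simp only [← Finsupp.single_add]
  congr 2 <;> ring

end Exactness

section Perturbation

lemma norm_inv_sub_inv_of_norm_eq_one {a b : ℂ} (ha : ‖a‖ = 1) (hb : ‖b‖ = 1) :
    ‖a⁻¹ - b⁻¹‖ = ‖a - b‖ := by
  have ha0 : a ≠ 0 := norm_ne_zero_iff.1 (by rw [ha]; exact one_ne_zero)
  have hb0 : b ≠ 0 := norm_ne_zero_iff.1 (by rw [hb]; exact one_ne_zero)
  rw [inv_sub_inv ha0 hb0, norm_div, norm_mul, ha, hb, norm_sub_rev]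
  simp

lemma norm_pow_sub_pow_le_of_norm_eq_one {a b : ℂ} (ha : ‖a‖ = 1) (hb : ‖b‖ = 1) (n : ℕ) :
    ‖a ^ n - b ^ n‖ ≤ n * ‖a - b‖ := by
  induction n with
  | zero => simp
  | succ n ih =>
    have h : a ^ (n + 1) - b ^ (n + 1) = (a ^ n - b ^ n) * a + b ^ n * (a - b) := by ring
    rw [h]
    refine (norm_add_le _ _).trans ?_
    rw [norm_mul, norm_mul, norm_pow, ha, hb, one_pow]
    push_cast
    linarith

lemma norm_zpow_sub_zpow_le_of_norm_eq_one {a b : ℂ} (ha : ‖a‖ = 1) (hb : ‖b‖ = 1) (k : ℤ) :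
    ‖a ^ k - b ^ k‖ ≤ k.natAbs * ‖a - b‖ := by
  obtain ⟨n, rfl | rfl⟩ := k.eq_nat_or_neg
  · simpa using norm_pow_sub_pow_le_of_norm_eq_one ha hb n
  · rw [_root_.zpow_neg, _root_.zpow_neg, norm_inv_sub_inv_of_norm_eq_one (by simp [ha]) (by simp [hb])]
    simpa using norm_pow_sub_pow_le_of_norm_eq_one ha hb n

variable {V : Type*} [NormedAddCommGroup V] [NormedSpace ℂ V]

lemma norm_comp_formalOp_sub_le {lam R C : ℝ} {z : ℂ} (hlam : 0 ≤ lam) (hz : ‖z‖ = 1)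
    (f : (ℤ × ℤ →₀ ℂ) →ₗ[ℂ] V)
    (hf : ∀ p : ℤ × ℤ, ‖f (Finsupp.single p 1)‖ ≤ C * 2 ^ p.1.natAbs) {r : ℂ} (hr : ‖r‖ ≤ R)
    (p : ℤ × ℤ) :
    ‖f ((formalOp lam z - algebraMap ℂ _ r) (Finsupp.single p 1))‖ ≤
      C * (4 * (1 + lam) + R) * 2 ^ p.1.natAbs := by
  have hC : 0 ≤ C := by simpa using (norm_nonneg _).trans (hf 0)
  have hs : ∀ (k j : ℤ) (c : ℂ), k.natAbs ≤ p.1.natAbs + 1 →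
      ‖f (Finsupp.single (k, j) c)‖ ≤ ‖c‖ * (C * 2 ^ (p.1.natAbs + 1)) := by
    intro k j c hk
    rw [← mul_one c, ← smul_eq_mul, ← Finsupp.smul_single, map_smul, norm_smul, smul_eq_mul, mul_one]
    refine mul_le_mul_of_nonneg_left ((hf _).trans (mul_le_mul_of_nonneg_left ?_ hC)) (norm_nonneg _)
    exact pow_le_pow_right₀ one_le_two hk
  have hl : ‖(lam : ℂ)‖ = lam := by rw [Complex.norm_real, Real.norm_of_nonneg hlam]
  have h1 := hs (p.1 + 1) p.2 1 (by omega)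
  have h2 := hs (p.1 + 1) (p.2 + 1) (lam * z ^ p.1) (by omega)
  have h3 := hs (p.1 - 1) p.2 1 (by omega)
  have h4 := hs (p.1 - 1) (p.2 - 1) (lam * (z ^ (p.1 - 1))⁻¹) (by omega)
  simp only [norm_mul, norm_inv, norm_zpow, hz, hl, _root_.one_zpow, inv_one, mul_one, norm_one,
    one_mul] at h1 h2 h3 h4
  have h5 : ‖r • f (Finsupp.single p 1)‖ ≤ R * (C * 2 ^ p.1.natAbs) := by
    rw [norm_smul]
    exact mul_le_mul hr (hf p) (norm_nonneg _) ((norm_nonneg _).trans hr)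
  rw [LinearMap.sub_apply, formalOp_single, one_smul, Module.algebraMap_end_apply, map_sub,
    map_smul]
  refine (norm_sub_le _ _).trans ?_
  simp only [map_add]
  have h6 := norm_add₄_le (a := f (Finsupp.single (p.1 + 1, p.2) 1))
    (b := f (Finsupp.single (p.1 + 1, p.2 + 1) (lam * z ^ p.1)))
    (c := f (Finsupp.single (p.1 - 1, p.2) 1))
    (d := f (Finsupp.single (p.1 - 1, p.2 - 1) (lam * (z ^ (p.1 - 1))⁻¹)))
  rw [add_assoc (_ + _)] at h6
  rw [pow_succ] at h1 h2 h3 h4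
  linarith

lemma norm_list_prod_formalOp_sub_le {lam R : ℝ} {z : ℂ} (hlam : 0 ≤ lam) (hz : ‖z‖ = 1)
    (l : List ℂ) (hl : ∀ r ∈ l, ‖r‖ ≤ R) :
    ∀ (C : ℝ) (f : (ℤ × ℤ →₀ ℂ) →ₗ[ℂ] V),
      (∀ p : ℤ × ℤ, ‖f (Finsupp.single p 1)‖ ≤ C * 2 ^ p.1.natAbs) →
      ‖f ((l.map fun r => formalOp lam z - algebraMap ℂ _ r).prod (Finsupp.single (0, 0) 1))‖ ≤
        C * (4 * (1 + lam) + R) ^ l.length := by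
  induction l with
  | nil => intro C f hf; simpa using hf (0, 0)
  | cons a l ih =>
    intro C f hf
    rw [List.map_cons, List.prod_cons, Module.End.mul_apply, List.length_cons, pow_succ', ← mul_assoc]
    exact ih (fun r hr => hl r (List.mem_cons_of_mem _ hr)) _
      (f ∘ₗ (formalOp lam z - algebraMap ℂ _ a)) fun p =>
        norm_comp_formalOp_sub_le hlam hz f hf (hl a List.mem_cons_self) p

variable {A : Type*} [NormedRing A] [NormedAlgebra ℂ A]

lemma norm_list_prod_sub_le {lam R C : ℝ} {z : ℂ} (hlam : 0 ≤ lam) (hz : ‖z‖ = 1) (h : A)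
    (hh : ‖h‖ ≤ 4 * (1 + lam)) (hA : ‖(1 : A)‖ ≤ 1)
    (Φ : (ℤ × ℤ →₀ ℂ) →ₗ[ℂ] A) (hΦ : Φ (Finsupp.single (0, 0) 1) = 1)
    (hC : ∀ p : ℤ × ℤ, ‖h * Φ (Finsupp.single p 1) - Φ (formalOp lam z (Finsupp.single p 1))‖ ≤
      C * 2 ^ p.1.natAbs)
    (l : List ℂ) (hl : ∀ r ∈ l, ‖r‖ ≤ R) :
    ‖(l.map fun r => h - algebraMap ℂ A r).prod -
        Φ ((l.map fun r => formalOp lam z - algebraMap ℂ _ r).prod (Finsupp.single (0, 0) 1))‖ ≤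
      l.length * C * (4 * (1 + lam) + R) ^ l.length := by
  have hC0 : 0 ≤ C := by simpa using (norm_nonneg _).trans (hC 0)
  induction l with
  | nil => simp [hΦ]
  | cons a l ih =>
    have ha := hl a List.mem_cons_self
    have hR : 0 ≤ R := (norm_nonneg _).trans ha
    have hl' : ∀ r ∈ l, ‖r‖ ≤ R := fun r hr => hl r (List.mem_cons_of_mem _ hr)
    have ih := ih hl'
    set x := (l.map fun r => formalOp lam z - algebraMap ℂ _ r).prod (Finsupp.single (0, 0) 1)
    set P := (l.map fun r => h - algebraMap ℂ A r).prod
    set Q := 4 * (1 + lam) + R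
    have hf := norm_list_prod_formalOp_sub_le hlam hz l hl' C
      (LinearMap.mulLeft ℂ h ∘ₗ Φ - Φ ∘ₗ formalOp lam z) hC
    rw [List.map_cons, List.map_cons, List.prod_cons, List.prod_cons, Module.End.mul_apply,
      List.length_cons]
    change ‖(h - algebraMap ℂ A a) * P - Φ ((formalOp lam z - algebraMap ℂ _ a) x)‖ ≤ _
    have heq : (h - algebraMap ℂ A a) * P - Φ ((formalOp lam z - algebraMap ℂ _ a) x) =
        (h - algebraMap ℂ A a) * (P - Φ x) + (h * Φ x - Φ (formalOp lam z x)) := by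
      rw [LinearMap.sub_apply, Module.algebraMap_end_apply, map_sub, map_smul, Algebra.smul_def]
      noncomm_ring
    have hQ : ‖h - algebraMap ℂ A a‖ ≤ Q := by
      refine (norm_sub_le _ _).trans (add_le_add hh ?_)
      rw [norm_algebraMap]
      nlinarith [norm_nonneg a]
    have hQ1 : 1 ≤ Q := by simp only [Q]; linarith
    rw [heq]
    refine (norm_add_le _ _).trans ((add_le_add ((norm_mul_le _ _).trans
      (mul_le_mul hQ ih (norm_nonneg _) (by linarith))) hf).trans ?_)
    push_cast
    have : C * Q ^ l.length ≤ C * Q ^ (l.length + 1) :=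
      mul_le_mul_of_nonneg_left (pow_le_pow_right₀ hQ1 (Nat.le_succ _)) hC0
    rw [pow_succ'] at this ⊢
    linarith

lemma aeval_map_eq_list_prod_add {p : ℝ[X]} {c : ℝ} {l : List ℝ}
    (hl : p - Polynomial.C c = (l.map fun r => X - Polynomial.C r).prod)
    {B : Type*} [Ring B] [Algebra ℂ B] (b : B) :
    aeval b (p.map (algebraMap ℝ ℂ)) =
      ((l.map (algebraMap ℝ ℂ)).map fun r => b - algebraMap ℂ B r).prod +
        algebraMap ℂ B (c : ℂ) := by
  rw [sub_eq_iff_eq_add.1 hl, Polynomial.map_add, Polynomial.map_C, Polynomial.map_list_prod,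
    List.map_map, map_add, aeval_C, map_list_prod, List.map_map, List.map_map]
  congr 3
  ext r
  simp

lemma norm_aeval_disc_sub_le {lam C : ℝ} {ζ : ℂ} {q : ℕ} (hlam : 0 < lam) (hq : 2 ≤ q)
    (hζ : IsPrimitiveRoot ζ q) (h : A) (hh : ‖h‖ ≤ 4 * (1 + lam)) (hA : ‖(1 : A)‖ ≤ 1)
    (Φ : (ℤ × ℤ →₀ ℂ) →ₗ[ℂ] A) (hΦ : Φ (Finsupp.single (0, 0) 1) = 1)
    (hC : ∀ p : ℤ × ℤ, ‖h * Φ (Finsupp.single p 1) - Φ (formalOp lam ζ (Finsupp.single p 1))‖ ≤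
      C * 2 ^ p.1.natAbs) :
    ‖aeval h ((disc lam ζ q).map (algebraMap ℝ ℂ)) -
        Φ (aeval (formalOp lam ζ) ((disc lam ζ q).map (algebraMap ℝ ℂ))
          (Finsupp.single (0, 0) 1))‖ ≤
      q * C * (6 * (1 + lam)) ^ q := by
  have hc : |2 * (1 + lam ^ q)| = 2 * (1 + lam ^ q) := abs_of_pos (by positivity)
  obtain ⟨l, hlq, hlR, hl⟩ := exists_list_disc_sub hlam hq hζ hc
  rw [aeval_map_eq_list_prod_add hl h]
  have key := norm_list_prod_sub_le (R := 2 * (1 + lam)) hlam.le (hζ.norm'_eq_one (by omega)) h hh hA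
    Φ hΦ hC (l.map (algebraMap ℝ ℂ)) (by simpa using hlR)
  have h6 : 4 * (1 + lam) + 2 * (1 + lam) = 6 * (1 + lam) := by ring
  rw [List.length_map, hlq, h6] at key
  refine le_trans (le_of_eq ?_) key
  congr 1
  rw [aeval_map_eq_list_prod_add hl (formalOp lam ζ), LinearMap.add_apply, map_add, Module.algebraMap_end_apply, map_smul,
    hΦ, Algebra.algebraMap_eq_smul_one, add_sub_add_right_eq_sub]

end Perturbation

section Rotation

variable {A : Type*} [CStarAlgebra A]

/-- The element `u + u⁻¹ + lam (u w + w⁻¹ u⁻¹)`. -/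
noncomputable def mathieu (lam : ℝ) (u w : unitary A) : A :=
  u + (lam : ℂ) • ((u * w : unitary A) : A) +
    (((u⁻¹ : unitary A) : A) + (lam : ℂ) • ((w⁻¹ * u⁻¹ : unitary A) : A))

variable {lam : ℝ} {z : ℂ} {u w : unitary A}

lemma coe_mul_zpow (hz : z ≠ 0) (h : ((w * u : unitary A) : A) = z • ((u * w : unitary A) : A))
    (k : ℤ) : ((w * u ^ k : unitary A) : A) = z ^ k • ((u ^ k * w : unitary A) : A) := by
  have hstep : ∀ k : ℤ, ((w * u ^ (k + 1) : unitary A) : A) =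
      z ^ (k + 1) • ((u ^ (k + 1) * w : unitary A) : A) ↔
      ((w * u ^ k : unitary A) : A) = z ^ k • ((u ^ k * w : unitary A) : A) := by
    intro k
    have h1 : ((w * u ^ (k + 1) : unitary A) : A) = ((w * u ^ k : unitary A) : A) * (u : A) := by
      norm_cast
      rw [_root_.zpow_add_one, mul_assoc]
    have h2 : z ^ (k + 1) • ((u ^ (k + 1) * w : unitary A) : A) =
        (z ^ k • ((u ^ k * w : unitary A) : A)) * (u : A) := by
      have h3 : ((u ^ (k + 1) * w : unitary A) : A) =
          ((u ^ k : unitary A) : A) * ((u * w : unitary A) : A) := by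
        norm_cast
        rw [_root_.zpow_add_one, mul_assoc]
      have h4 : ((u ^ k * w : unitary A) : A) * (u : A) =
          ((u ^ k : unitary A) : A) * ((w * u : unitary A) : A) := by
        norm_cast
        rw [mul_assoc]
      rw [smul_mul_assoc, h4, h, h3, mul_smul_comm, smul_smul, zpow_add_one₀ hz]
    rw [h1, h2, Unitary.mul_left_inj]
  induction k using Int.induction_on with
  | zero => simp
  | succ n ih => exact (hstep _).2 ih
  | pred n ih =>
    refine (hstep _).1 ?_
    rwa [sub_add_cancel]

lemma coe_inv_mul_zpow (hz : z ≠ 0)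
    (h : ((w * u : unitary A) : A) = z • ((u * w : unitary A) : A)) (k : ℤ) :
    ((w⁻¹ * u ^ k : unitary A) : A) = (z ^ k)⁻¹ • ((u ^ k * w⁻¹ : unitary A) : A) := by
  rw [eq_inv_smul_iff₀ (zpow_ne_zero k hz)]
  have h1 : ((u ^ k * w⁻¹ : unitary A) : A) =
      ((w⁻¹ : unitary A) : A) * ((w * u ^ k : unitary A) : A) * ((w⁻¹ : unitary A) : A) := by
    norm_cast
    group
  have h2 : ((w⁻¹ * u ^ k : unitary A) : A) =
      ((w⁻¹ : unitary A) : A) * ((u ^ k * w : unitary A) : A) * ((w⁻¹ : unitary A) : A) := by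
    norm_cast
    group
  rw [h1, h2, coe_mul_zpow hz h, mul_smul_comm, smul_mul_assoc]

/-- The monomial `u ^ k w ^ j`. -/
noncomputable def toRotation (u w : unitary A) : (ℤ × ℤ →₀ ℂ) →ₗ[ℂ] A :=
  Finsupp.linearCombination ℂ fun p : ℤ × ℤ => ((u ^ p.1 * w ^ p.2 : unitary A) : A)

lemma toRotation_single (u w : unitary A) (p : ℤ × ℤ) (c : ℂ) :
    toRotation u w (Finsupp.single p c) = c • ((u ^ p.1 * w ^ p.2 : unitary A) : A) := by
  rw [toRotation, Finsupp.linearCombination_single]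

lemma mathieu_mul_toRotation (hz : z ≠ 0)
    (h : ((w * u : unitary A) : A) = z • ((u * w : unitary A) : A)) (p : ℤ × ℤ) :
    mathieu lam u w * toRotation u w (Finsupp.single p 1) =
      toRotation u w (formalOp lam z (Finsupp.single p 1)) := by
  simp only [formalOp_single, map_add, toRotation_single, mathieu, one_smul, add_mul,
    smul_mul_assoc]
  congr 2
  · norm_cast
    rw [add_comm p.1, _root_.zpow_one_add, mul_assoc]
  · rw [mul_smul]
    congr 1
    have h1 : ((u * w : unitary A) : A) * ((u ^ p.1 * w ^ p.2 : unitary A) : A) =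
        (u : A) * ((w * u ^ p.1 : unitary A) : A) * ((w ^ p.2 : unitary A) : A) := by
      norm_cast
      simp only [mul_assoc]
    have h2 : ((u ^ (p.1 + 1) * w ^ (p.2 + 1) : unitary A) : A) =
        (u : A) * ((u ^ p.1 * w : unitary A) : A) * ((w ^ p.2 : unitary A) : A) := by
      norm_cast
      rw [add_comm p.1, add_comm p.2, _root_.zpow_one_add, _root_.zpow_one_add]
      simp only [mul_assoc]
    rw [h1, h2, coe_mul_zpow hz h, mul_smul_comm, smul_mul_assoc]
  · norm_cast
    rw [sub_eq_neg_add, _root_.zpow_add, _root_.zpow_neg_one, mul_assoc]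
  · rw [mul_smul]
    congr 1
    have h1 : ((w⁻¹ * u⁻¹ : unitary A) : A) * ((u ^ p.1 * w ^ p.2 : unitary A) : A) =
        ((w⁻¹ * u ^ (p.1 - 1) : unitary A) : A) * ((w ^ p.2 : unitary A) : A) := by
      norm_cast
      rw [sub_eq_neg_add, _root_.zpow_add, _root_.zpow_neg_one]
      simp only [mul_assoc]
    have h2 : ((u ^ (p.1 - 1) * w ^ (p.2 - 1) : unitary A) : A) =
        ((u ^ (p.1 - 1) * w⁻¹ : unitary A) : A) * ((w ^ p.2 : unitary A) : A) := by
      norm_cast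
      rw [sub_eq_neg_add p.2, _root_.zpow_add w, _root_.zpow_neg_one]
      simp only [mul_assoc]
    rw [h1, h2, coe_inv_mul_zpow hz h, smul_mul_assoc]

variable [Nontrivial A]

lemma norm_mathieu_le (hlam : 0 ≤ lam) (u w : unitary A) :
    ‖mathieu lam u w‖ ≤ 2 * (1 + lam) := by
  have h := norm_add₄_le (a := (u : A)) (b := (lam : ℂ) • ((u * w : unitary A) : A))
    (c := ((u⁻¹ : unitary A) : A)) (d := (lam : ℂ) • ((w⁻¹ * u⁻¹ : unitary A) : A))
  rw [add_assoc (_ + _)] at h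
  simp only [norm_smul, CStarRing.norm_coe_unitary, Complex.norm_real, Real.norm_of_nonneg hlam]
    at h
  refine h.trans (le_of_eq ?_)
  ring

lemma norm_aeval_mathieu_le (hlam : 0 < lam) (hz : ‖z‖ = 1)
    (h : ((w * u : unitary A) : A) = z • ((u * w : unitary A) : A))
    {ζ : ℂ} {q : ℕ} (hq : 2 ≤ q) (hζ : IsPrimitiveRoot ζ q) :
    ‖aeval (mathieu lam u w) ((disc lam ζ q).map (algebraMap ℝ ℂ))‖ ≤
      2 * (1 + lam ^ q) + q * (2 * lam * ‖z - ζ‖) * (6 * (1 + lam)) ^ q := by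
  have hζ1 : ‖ζ‖ = 1 := hζ.norm'_eq_one (by omega)
  have hl : ‖(lam : ℂ)‖ = lam := by rw [Complex.norm_real, Real.norm_of_nonneg hlam.le]
  have hu : ∀ (x : unitary A) (c : ℂ), ‖c • (x : A)‖ = ‖c‖ := fun x c => by
    rw [norm_smul, CStarRing.norm_coe_unitary, mul_one]
  have hC : ∀ p : ℤ × ℤ, ‖mathieu lam u w * toRotation u w (Finsupp.single p 1) -
      toRotation u w (formalOp lam ζ (Finsupp.single p 1))‖ ≤
        2 * lam * ‖z - ζ‖ * 2 ^ p.1.natAbs := by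
    intro p
    rw [mathieu_mul_toRotation (norm_ne_zero_iff.1 (by rw [hz]; exact one_ne_zero)) h]
    simp only [formalOp_single, map_add, toRotation_single, one_smul]
    rw [add_sub_add_comm, add_sub_add_left_eq_sub, add_sub_add_left_eq_sub, ← sub_smul, ← sub_smul]
    refine (norm_add_le _ _).trans ?_
    rw [hu, hu, ← mul_sub, ← mul_sub, norm_mul, norm_mul, hl,
      norm_inv_sub_inv_of_norm_eq_one (by simp [hz]) (by simp [hζ1])]
    have h1 := norm_zpow_sub_zpow_le_of_norm_eq_one hz hζ1 p.1
    have h2 := norm_zpow_sub_zpow_le_of_norm_eq_one hz hζ1 (p.1 - 1)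
    have h3 : ∀ n m : ℕ, m ≤ n + 1 → (m : ℝ) * ‖z - ζ‖ ≤ 2 ^ n * ‖z - ζ‖ := fun n m hm => by
      refine mul_le_mul_of_nonneg_right ?_ (norm_nonneg _)
      exact_mod_cast hm.trans (Nat.lt_two_pow_self (n := n))
    have h4 := h1.trans (h3 p.1.natAbs _ (by omega))
    have h5 := h2.trans (h3 p.1.natAbs _ (by omega))
    have h6 := mul_le_mul_of_nonneg_left (add_le_add h4 h5) hlam.le
    linarith
  have key := norm_aeval_disc_sub_le hlam hq hζ (mathieu lam u w)
    ((norm_mathieu_le hlam.le u w).trans (by linarith)) norm_one.le (toRotation u w)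
    (by simp [toRotation_single]) hC
  rw [aeval_formalOp_disc hlam hq hζ] at key
  simp only [map_add, toRotation_single, one_smul] at key
  rw [← sub_add_cancel (aeval (mathieu lam u w) _)]
  refine (norm_add_le _ _).trans ((add_le_add key ?_).trans (add_comm _ _).le)
  refine (norm_add_le _ _).trans ?_
  refine (add_le_add (norm_add_le _ _) (norm_add_le _ _)).trans (le_of_eq ?_)
  simp only [hu, norm_neg, norm_pow, hl, CStarRing.norm_coe_unitary]
  ring

lemma abs_eval_disc_le_of_mem_spectrum (hlam : 0 < lam) (hz : ‖z‖ = 1)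
    (h : ((w * u : unitary A) : A) = z • ((u * w : unitary A) : A))
    {ζ : ℂ} {q : ℕ} (hq : 2 ≤ q) (hζ : IsPrimitiveRoot ζ q) {E : ℝ}
    (hE : (E : ℂ) ∈ spectrum ℂ (mathieu lam u w)) :
    |(disc lam ζ q).eval E| ≤
      2 * (1 + lam ^ q) + q * (2 * lam * ‖z - ζ‖) * (6 * (1 + lam)) ^ q := by
  have h1 := spectrum.subset_polynomial_aeval (mathieu lam u w)
    ((disc lam ζ q).map (algebraMap ℝ ℂ)) ⟨_, hE, rfl⟩
  have h2 := (spectrum.norm_le_norm_of_mem h1).trans (norm_aeval_mathieu_le hlam hz h hq hζ)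
  have h3 : ((disc lam ζ q).map (algebraMap ℝ ℂ)).eval (E : ℂ) =
      (((disc lam ζ q).eval E : ℝ) : ℂ) := by
    rw [eval_map_algebraMap, ← Complex.coe_algebraMap, aeval_algebraMap_apply, coe_aeval_eq_eval]
  beta_reduce at h2
  rwa [h3, Complex.norm_real, Real.norm_eq_abs] at h2

end Rotation

section Operator

/-- The Hilbert space `ℓ²(ℤ)`. -/
noncomputable abbrev HilbertZ := lp (fun _ : ℤ => ℂ) 2

instance : Nontrivial HilbertZ :=
  ⟨lp.single 2 0 1, 0, fun h => one_ne_zero (α := ℂ) (by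
    simpa using congrArg (fun ψ : HilbertZ => ψ 0) h)⟩

lemma norm_circle_mul (a : Circle) (x : ℂ) : ‖(a : ℂ) * x‖ = ‖x‖ := by
  rw [norm_mul, Circle.norm_coe, one_mul]

/-- The unitary operator `(W ψ) n = a n * ψ (e n)` on `ℓ²(ℤ)`. -/
noncomputable def weightedShift (a : ℤ → Circle) (e : ℤ ≃ ℤ) :
    HilbertZ ≃ₗᵢ[ℂ] HilbertZ where
  toFun ψ := ⟨fun n => a n * ψ (e n), by
    have h := (memℓp_gen_iff (by norm_num)).1 (lp.memℓp ψ)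
    refine (memℓp_gen_iff (by norm_num)).2 ?_
    exact (e.summable_iff.2 h).congr fun n => by rw [norm_circle_mul]; rfl⟩
  invFun ψ := ⟨fun n => ((a (e.symm n))⁻¹ : Circle) * ψ (e.symm n), by
    have h := (memℓp_gen_iff (by norm_num)).1 (lp.memℓp ψ)
    refine (memℓp_gen_iff (by norm_num)).2 ?_
    exact (e.symm.summable_iff.2 h).congr fun n => by rw [norm_circle_mul]; rfl⟩
  map_add' ψ φ := by
    ext n
    exact mul_add _ _ _
  map_smul' c ψ := by
    ext n
    exact mul_left_comm _ _ _
  left_inv ψ := by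
    ext n
    simp
  right_inv ψ := by
    ext n
    simp
  norm_map' ψ := by
    rw [lp.norm_eq_tsum_rpow (by norm_num), lp.norm_eq_tsum_rpow (by norm_num)]
    congr 1
    rw [← e.tsum_eq fun n => ‖ψ n‖ ^ _]
    exact tsum_congr fun n => congrArg (· ^ _) (norm_circle_mul _ _)

lemma weightedShift_apply (a : ℤ → Circle) (e : ℤ ≃ ℤ) (ψ : HilbertZ) (n : ℤ) :
    weightedShift a e ψ n = a n * ψ (e n) := rfl

lemma weightedShift_symm_apply (a : ℤ → Circle) (e : ℤ ≃ ℤ) (ψ : HilbertZ) (n : ℤ) :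
    (weightedShift a e).symm ψ n = ((a (e.symm n))⁻¹ : Circle) * ψ (e.symm n) := rfl

lemma exists_unitary_eq_mathieu {α lam ω : ℝ}
    {H : HilbertZ →L[ℂ] HilbertZ}
    (hH : ∀ (ψ : HilbertZ) (n : ℤ),
      (H ψ) n = ψ (n + 1) + ψ (n - 1) +
        (↑(2 * lam * Real.cos (2 * Real.pi * (ω + n * α))) : ℂ) * ψ n) :
    ∃ u w : unitary (HilbertZ →L[ℂ] HilbertZ),
      H = mathieu lam u w ∧
      ((w * u : unitary (HilbertZ →L[ℂ] HilbertZ)) : HilbertZ →L[ℂ] HilbertZ) =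
        (Circle.exp (-(2 * Real.pi * α)) : ℂ) • ((u * w : unitary (HilbertZ →L[ℂ] HilbertZ)) : HilbertZ →L[ℂ] HilbertZ) ∧
      ∀ (ψ : HilbertZ) (n : ℤ), (u : HilbertZ →L[ℂ] HilbertZ) ψ n = ψ (n + 1) := by
  set c : ℤ → Circle := fun n => Circle.exp (2 * Real.pi * (ω + n * α)) with hc
  set U := weightedShift 1 (Equiv.addRight 1)
  set W := weightedShift (fun n => c (n - 1)) (Equiv.subRight 1)
  have hU : ∀ (ψ : HilbertZ) (n : ℤ), U ψ n = ψ (n + 1) := fun ψ n => by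
    simp [U, weightedShift_apply]
  have hW : ∀ (ψ : HilbertZ) (n : ℤ), W ψ n = c (n - 1) * ψ (n - 1) := fun ψ n => by
    simp [W, weightedShift_apply]
  have hU' : ∀ (ψ : HilbertZ) (n : ℤ), U.symm ψ n = ψ (n - 1) := fun ψ n => by
    simp [U, weightedShift_symm_apply, sub_eq_add_neg]
  have hW' : ∀ (ψ : HilbertZ) (n : ℤ), W.symm ψ n = ((c n)⁻¹ : Circle) * ψ (n + 1) :=
    fun ψ n => by simp [W, weightedShift_symm_apply]
  refine ⟨Unitary.linearIsometryEquiv.symm U, Unitary.linearIsometryEquiv.symm W, ?_, ?_, hU⟩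
  · ext ψ n
    rw [mathieu, ← map_inv, ← map_inv, ← map_mul, ← map_mul, hH]
    simp only [Unitary.coe_symm_linearIsometryEquiv_apply]
    change _ = (U ψ n + lam * U (W ψ) n) + (U.symm ψ n + lam * W.symm (U.symm ψ) n)
    rw [hU, hU', hU, hW, hW', hU', add_sub_cancel_right]
    have hcos : ((2 * lam * Real.cos (2 * Real.pi * (ω + n * α)) : ℝ) : ℂ) =
        lam * ((c n : ℂ) + ((c n)⁻¹ : Circle)) := by
      rw [hc, ← Circle.exp_neg, Circle.coe_exp, Circle.coe_exp]
      push_cast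
      rw [mul_comm 2 (lam : ℂ), mul_assoc, Complex.two_cos]
    rw [hcos]
    ring
  · ext ψ n
    rw [← map_mul, ← map_mul]
    simp only [Unitary.coe_symm_linearIsometryEquiv_apply]
    change W (U ψ) n = Circle.exp (-(2 * Real.pi * α)) * U (W ψ) n
    rw [hU, hW, hW, hU, add_sub_cancel_right, sub_add_cancel, ← mul_assoc, hc]
    norm_cast
    rw [← Circle.exp_add]
    push_cast
    congr 3
    ring

end Operator

section Liouville

variable {α : ℝ}

lemma exists_rat_approx (hα : IsLiouvilleFrequency α) (N : ℕ) {B : ℝ} (hB : 0 < B) :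
    ∃ r : ℚ, N ≤ r.den ∧ |α - r| * B ^ r.den < 1 := by
  obtain ⟨hirr, p, q, hq, -, happrox⟩ := hα
  set x := (N.factorial : ℝ) * α
  have hN : (0 : ℝ) < N.factorial := by exact_mod_cast N.factorial_pos
  have hx : Irrational x := hirr.natCast_mul N.factorial_ne_zero
  have hd : 0 < |x - round x| := abs_pos.2 (sub_ne_zero.2 (hx.ne_int _))
  obtain ⟨k, hk⟩ := exists_nat_gt (max (max B 1) (N.factorial / |x - round x|))
  have hkB : B < k := (le_max_left _ _).trans_lt ((le_max_left _ _).trans_lt hk)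
  have hk1 : (1 : ℝ) < k := (le_max_right _ _).trans_lt ((le_max_left _ _).trans_lt hk)
  have hkd : N.factorial / |x - round x| < k := (le_max_right _ _).trans_lt hk
  have hk0 : 0 < k := by exact_mod_cast zero_lt_one.trans hk1
  set r : ℚ := (p k : ℚ) / (q k : ℚ) with hr
  have hrc : (r : ℝ) = (p k : ℝ) / (q k : ℝ) := by simp [hr]
  have hden : r.den ≤ q k := by
    refine Nat.le_of_dvd (hq k) ?_
    have h := Rat.den_dvd (p k) (q k)
    rw [Rat.divInt_eq_div, Int.cast_natCast, ← hr] at h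
    exact_mod_cast h
  have hlt : |α - r| * k ^ q k < 1 := by
    have := happrox k hk0
    rwa [← hrc, lt_div_iff₀ (by positivity)] at this
  have hpow : ∀ m : ℕ, m ≤ q k → |α - r| * k ^ m < 1 := fun m hm =>
    (mul_le_mul_of_nonneg_left (pow_le_pow_right₀ hk1.le hm) (abs_nonneg _)).trans_lt hlt
  refine ⟨r, ?_, (mul_le_mul_of_nonneg_left (pow_le_pow_left₀ hB.le hkB.le _)
    (abs_nonneg _)).trans_lt (hpow _ hden)⟩
  by_contra! hlt
  obtain ⟨m, hm⟩ := Nat.dvd_factorial r.den_pos hlt.le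
  have hint : (N.factorial : ℝ) * r = ((m * r.num : ℤ) : ℝ) := by
    have h1 : (N.factorial : ℚ) * r = ((m * r.num : ℤ) : ℚ) := by
      rw [hm]
      push_cast
      rw [mul_comm (r.den : ℚ), mul_assoc, mul_comm (r.den : ℚ), Rat.mul_den_eq_num]
    exact_mod_cast h1
  have h1 := hpow 1 (hq k)
  rw [pow_one] at h1
  have h2 := round_le x (m * r.num)
  rw [← hint, ← mul_sub, abs_mul, Nat.abs_cast] at h2
  rw [div_lt_iff₀ hd] at hkd
  nlinarith

lemma norm_circleExp_sub_le (x y : ℝ) : ‖(Circle.exp x : ℂ) - Circle.exp y‖ ≤ |x - y| := by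
  have h : (Circle.exp x : ℂ) - Circle.exp y =
      Circle.exp y * (Complex.exp (Complex.I * (x - y : ℝ)) - 1) := by
    rw [mul_sub, mul_one, Circle.coe_exp, Circle.coe_exp, ← Complex.exp_add]
    congr 2
    push_cast
    ring
  rw [h, norm_mul, Circle.norm_coe, one_mul]
  exact Real.norm_exp_I_mul_ofReal_sub_one_le

lemma isPrimitiveRoot_circleExp (r : ℚ) :
    IsPrimitiveRoot (Circle.exp (-(2 * Real.pi * r)) : ℂ) r.den := by
  have h := (Complex.isPrimitiveRoot_exp r.den r.den_ne_zero).zpow_of_gcd_eq_one (-r.num)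
    (by simpa [Int.gcd] using r.reduced)
  rw [← Complex.exp_int_mul] at h
  rw [Circle.coe_exp]
  refine (congrArg (IsPrimitiveRoot · r.den) (congrArg Complex.exp ?_)).mp h
  have hr : ((r : ℝ) : ℂ) = (r.num : ℂ) / r.den := by
    norm_cast
    exact_mod_cast (Rat.num_div_den r).symm
  push_cast at hr ⊢
  rw [hr]
  ring

lemma exists_primitiveRoot_approx (hα : IsLiouvilleFrequency α) (N : ℕ) {B : ℝ} (hB : 0 < B) :
    ∃ q : ℕ, N ≤ q ∧ ∃ ζ : ℂ, IsPrimitiveRoot ζ q ∧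
      q * ‖(Circle.exp (-(2 * Real.pi * α)) : ℂ) - ζ‖ * B ^ q ≤ 1 := by
  have hpi := Real.pi_pos
  obtain ⟨r, hr, hrB⟩ := exists_rat_approx hα N (B := 2 * (2 * Real.pi + 1) * B) (by positivity)
  refine ⟨r.den, hr, _, isPrimitiveRoot_circleExp r, ?_⟩
  have h1 := norm_circleExp_sub_le (-(2 * Real.pi * α)) (-(2 * Real.pi * r))
  rw [← neg_sub', ← mul_sub, abs_neg, abs_mul, abs_of_pos (by positivity)] at h1
  have h2 : (r.den : ℝ) ≤ 2 ^ r.den := by exact_mod_cast Nat.lt_two_pow_self.le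
  have h3 : 2 * Real.pi ≤ (2 * Real.pi + 1) ^ r.den :=
    (le_add_of_nonneg_right zero_le_one).trans (le_self_pow₀ (by linarith) r.den_ne_zero)
  calc _ ≤ 2 ^ r.den * ((2 * Real.pi + 1) ^ r.den * |α - r|) * B ^ r.den := by
        gcongr
        exact h1.trans (mul_le_mul_of_nonneg_right h3 (abs_nonneg _))
    _ = |α - r| * (2 * (2 * Real.pi + 1) * B) ^ r.den := by
        rw [mul_pow, mul_pow]
        ring
    _ ≤ 1 := hrB.le

end Liouville

section Isolated

lemma exists_pseudoinverse {A : Type*} [CStarAlgebra A] {h : A} (hh : IsSelfAdjoint h) {E : ℝ}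
    (hE : E ∈ spectrum ℝ h) (hiso : E ∉ closure (spectrum ℝ h \ {E})) :
    ∃ G : A, (h - algebraMap ℝ A E) * (1 - G * (h - algebraMap ℝ A E)) = 0 ∧
      1 - G * (h - algebraMap ℝ A E) ≠ 0 := by
  set g : ℝ → ℝ := fun x => (x - E)⁻¹
  have hg : ContinuousOn g (spectrum ℝ h) := by
    intro x hx
    by_cases hxE : x = E
    · subst hxE
      rw [← continuousWithinAt_sdiff_self, ContinuousWithinAt,
        notMem_closure_iff_nhdsWithin_eq_bot.1 hiso]
      exact Filter.tendsto_bot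
    · exact ((continuousAt_id.sub continuousAt_const).inv₀ (sub_ne_zero.2 hxE)).continuousWithinAt
  have hT : h - algebraMap ℝ A E = cfc (fun x => x - E) h := by
    rw [cfc_sub (fun x => x) (fun _ => E) h, cfc_id' ℝ h, cfc_const E h]
  have hcomm : cfc g h * cfc (fun x => x - E) h = cfc (fun x => x - E) h * cfc g h := by
    rw [← cfc_mul g (fun x => x - E) h, ← cfc_mul (fun x => x - E) g h]
    simp only [mul_comm]
  refine ⟨cfc g h, ?_, fun h0 => ?_⟩
  · rw [hT, mul_sub, mul_one, ← cfc_mul g (fun x => x - E) h,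
      ← cfc_mul (fun x => x - E) (fun x => g x * (x - E)) h, sub_eq_zero]
    refine cfc_congr fun x _ => ?_
    by_cases hxE : x = E
    · simp [hxE]
    · simp only [g]
      rw [inv_mul_cancel₀ (sub_ne_zero.2 hxE), mul_one]
  · rw [hT, sub_eq_zero] at h0
    refine spectrum.mem_iff.1 hE ?_
    rw [← neg_sub, IsUnit.neg_iff, hT]
    exact ⟨⟨_, cfc g h, hcomm ▸ h0.symm, h0.symm⟩, rfl⟩

variable {A : Type*} [CStarAlgebra A] {lam : ℝ} {z : ℂ} {u w : unitary A}

lemma isSelfAdjoint_mathieu (lam : ℝ) (u w : unitary A) : IsSelfAdjoint (mathieu lam u w) := by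
  rw [isSelfAdjoint_iff, mathieu]
  simp only [star_add, star_smul, ← Unitary.coe_star, Unitary.star_eq_inv, _root_.mul_inv_rev, inv_inv,
    Complex.star_def, Complex.conj_ofReal]
  exact add_comm _ _

lemma norm_mathieu_mul_pow_sub_le [Nontrivial A] (hlam : 0 ≤ lam) (hz : ‖z‖ = 1)
    (h : ((w * u : unitary A) : A) = z • ((u * w : unitary A) : A)) (n : ℕ) :
    ‖mathieu lam u w * ((u ^ n : unitary A) : A) - ((u ^ n : unitary A) : A) * mathieu lam u w‖ ≤
      2 * lam * ‖z ^ n - 1‖ := by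
  have hz0 : z ≠ 0 := norm_ne_zero_iff.1 (by rw [hz]; exact one_ne_zero)
  have h1 : ((u * w : unitary A) : A) * ((u ^ n : unitary A) : A) =
      z ^ n • ((u ^ (n + 1) * w : unitary A) : A) := by
    have h2 := coe_mul_zpow hz0 h n
    rw [zpow_natCast, zpow_natCast] at h2
    have h3 : ((u * w : unitary A) : A) * ((u ^ n : unitary A) : A) =
        (u : A) * ((w * u ^ n : unitary A) : A) := by
      norm_cast
      rw [mul_assoc]
    have h4 : ((u ^ (n + 1) * w : unitary A) : A) = (u : A) * ((u ^ n * w : unitary A) : A) := by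
      norm_cast
      rw [pow_succ', mul_assoc]
    rw [h3, h2, h4, mul_smul_comm]
  have h1' : ((u ^ n : unitary A) : A) * ((u * w : unitary A) : A) =
      ((u ^ (n + 1) * w : unitary A) : A) := by
    norm_cast
    rw [pow_succ, mul_assoc]
  have h5 : ((w⁻¹ * u⁻¹ : unitary A) : A) * ((u ^ n : unitary A) : A) =
      (z ^ n)⁻¹ • ((u ^ n * (w⁻¹ * u⁻¹) : unitary A) : A) := by
    have h2 := coe_inv_mul_zpow hz0 h n
    rw [zpow_natCast, zpow_natCast] at h2
    have h3 : ((w⁻¹ * u⁻¹ : unitary A) : A) * ((u ^ n : unitary A) : A) =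
        ((w⁻¹ * u ^ n : unitary A) : A) * ((u⁻¹ : unitary A) : A) := by
      norm_cast
      group
    have h4 : ((u ^ n * (w⁻¹ * u⁻¹) : unitary A) : A) =
        ((u ^ n * w⁻¹ : unitary A) : A) * ((u⁻¹ : unitary A) : A) := by
      norm_cast
      rw [mul_assoc]
    rw [h3, h2, h4, smul_mul_assoc]
  have h5' : ((u ^ n : unitary A) : A) * ((w⁻¹ * u⁻¹ : unitary A) : A) =
      ((u ^ n * (w⁻¹ * u⁻¹) : unitary A) : A) := rfl
  have h6 : (u : A) * ((u ^ n : unitary A) : A) = ((u ^ n : unitary A) : A) * (u : A) := by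
    norm_cast
    rw [← pow_succ, pow_succ']
  have h7 : ((u⁻¹ : unitary A) : A) * ((u ^ n : unitary A) : A) =
      ((u ^ n : unitary A) : A) * ((u⁻¹ : unitary A) : A) := by
    norm_cast
    group
  have heq : mathieu lam u w * ((u ^ n : unitary A) : A) -
      ((u ^ n : unitary A) : A) * mathieu lam u w =
      (lam * (z ^ n - 1)) • ((u ^ (n + 1) * w : unitary A) : A) +
        (lam * ((z ^ n)⁻¹ - 1⁻¹)) • ((u ^ n * (w⁻¹ * u⁻¹) : unitary A) : A) := by
    simp only [mathieu, add_mul, mul_add, smul_mul_assoc, mul_smul_comm, h1, h1', h5, h5', h6, h7,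
      inv_one]
    module
  rw [heq]
  refine (norm_add_le _ _).trans (le_of_eq ?_)
  rw [norm_smul, norm_smul, norm_mul, norm_mul, CStarRing.norm_coe_unitary,
    CStarRing.norm_coe_unitary, norm_inv_sub_inv_of_norm_eq_one (by simp [hz]) norm_one,
    Complex.norm_real, Real.norm_of_nonneg hlam]
  ring

end Isolated

section Eigenvectors

lemma eq_zero_of_recurrence {a ψ : ℤ → ℂ} (h : ∀ n, ψ (n + 1) + ψ (n - 1) = a n * ψ n)
    (h0 : ψ 0 = 0) (h1 : ψ 1 = 0) (n : ℤ) : ψ n = 0 := by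
  have key : ∀ n : ℤ, ψ n = 0 ∧ ψ (n + 1) = 0 := by
    intro n
    induction n using Int.induction_on with
    | zero => exact ⟨h0, by simpa using h1⟩
    | succ n ih =>
      refine ⟨ih.2, ?_⟩
      have := h (n + 1)
      rw [ih.2, add_sub_cancel_right, ih.1] at this
      simpa using this
    | pred n ih =>
      have := h (-n)
      rw [ih.1, ih.2] at this
      refine ⟨by simpa using this, ?_⟩
      rw [sub_add_cancel]
      exact ih.1
  exact (key n).1

lemma exists_norm_le_of_mem_ker {T : HilbertZ →L[ℂ] HilbertZ} {a : ℤ → ℂ}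
    (hT : ∀ (ψ : HilbertZ) (n : ℤ), T ψ n = ψ (n + 1) + ψ (n - 1) - a n * ψ n) :
    ∃ C : ℝ, 0 ≤ C ∧ ∀ ψ : HilbertZ, T ψ = 0 → ‖ψ‖ ≤ C * max ‖ψ 0‖ ‖ψ 1‖ := by
  let K := LinearMap.ker T.toLinearMap
  let ev : K →ₗ[ℂ] ℂ × ℂ :=
    { toFun := fun ψ => ((ψ : HilbertZ) 0, (ψ : HilbertZ) 1)
      map_add' := fun _ _ => rfl
      map_smul' := fun _ _ => rfl }
  have hev : LinearMap.ker ev = ⊥ := by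
    refine LinearMap.ker_eq_bot'.2 fun ψ hψ => ?_
    have hψT : T (ψ : HilbertZ) = 0 := ψ.2
    ext n
    refine eq_zero_of_recurrence (a := a) (fun n => ?_) (congrArg Prod.fst hψ)
      (congrArg Prod.snd hψ) n
    rw [← sub_eq_zero, ← hT, hψT]
    rfl
  have : FiniteDimensional ℂ K := FiniteDimensional.of_injective ev (LinearMap.ker_eq_bot.1 hev)
  obtain ⟨C, -, hC⟩ := ev.exists_antilipschitzWith hev
  exact ⟨C, C.2, fun ψ hψ => ZeroHomClass.bound_of_antilipschitz ev hC ⟨ψ, hψ⟩⟩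

lemma tendsto_coe_nat_add (ψ : HilbertZ) (k : ℤ) :
    Filter.Tendsto (fun n : ℕ => ‖ψ (k + n)‖) Filter.atTop (nhds 0) := by
  have h := ((memℓp_gen_iff (by norm_num)).1 (lp.memℓp ψ)).tendsto_cofinite_zero
  have hinj : Function.Injective fun n : ℕ => k + n := fun a b hab => by simpa using hab
  have h2 := (h.comp hinj.tendsto_cofinite).sqrt
  rw [Nat.cofinite_eq_atTop, Real.sqrt_zero] at h2
  simpa [Function.comp_def, Real.sqrt_sq] using h2

end Eigenvectors

section Cantor

variable {α lam ω : ℝ} {H : HilbertZ →L[ℂ] HilbertZ}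

lemma mem_closure_spectrum_sdiff (hα : IsLiouvilleFrequency α) (hlam : 0 < lam)
    (hH : ∀ (ψ : HilbertZ) (n : ℤ), (H ψ) n = ψ (n + 1) + ψ (n - 1) +
        (↑(2 * lam * Real.cos (2 * Real.pi * (ω + n * α))) : ℂ) * ψ n)
    {E : ℝ} (hE : E ∈ spectrum ℝ H) : E ∈ closure (spectrum ℝ H \ {E}) := by
  by_contra hiso
  obtain ⟨u, w, hHu, hwu, hu⟩ := exists_unitary_eq_mathieu hH
  set z : ℂ := (Circle.exp (-(2 * Real.pi * α))).val
  have hz : ‖z‖ = 1 := Circle.norm_coe _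
  obtain ⟨G, hG, hG0⟩ := exists_pseudoinverse (hHu ▸ isSelfAdjoint_mathieu lam u w) hE hiso
  set T := H - algebraMap ℝ (HilbertZ →L[ℂ] HilbertZ) E with hT
  have hTapp : ∀ ψ : HilbertZ, T ψ = H ψ - (E : ℂ) • ψ := fun ψ => rfl
  have hTrec : ∀ (ψ : HilbertZ) (n : ℤ), T ψ n = ψ (n + 1) + ψ (n - 1) -
      (E - (2 * lam * Real.cos (2 * Real.pi * (ω + n * α)) : ℝ)) * ψ n := fun ψ n => by
    rw [hTapp]
    change H ψ n - E * ψ n = _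
    rw [hH]
    ring
  obtain ⟨C, hC, hker⟩ := exists_norm_le_of_mem_ker hTrec
  have hTP : ∀ ψ : HilbertZ, T ((1 - G * T) ψ) = 0 := fun ψ => congrArg (· ψ) hG
  obtain ⟨φ, hφ0, hφ⟩ : ∃ φ : HilbertZ, φ ≠ 0 ∧ T φ = 0 := by
    by_contra! hne
    refine hG0 (ContinuousLinearMap.ext fun ψ => ?_)
    by_contra hψ
    exact hne _ hψ (hTP ψ)
  have hun : ∀ (n : ℕ) (k : ℤ), ((u ^ n : unitary (HilbertZ →L[ℂ] HilbertZ)) :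
      HilbertZ →L[ℂ] HilbertZ) φ k = φ (k + n) := by
    intro n
    induction n with
    | zero => intro k; simp
    | succ n ih =>
      intro k
      rw [pow_succ']
      change (u : HilbertZ →L[ℂ] HilbertZ) (((u ^ n : unitary (HilbertZ →L[ℂ] HilbertZ)) :
        HilbertZ →L[ℂ] HilbertZ) φ) k = _
      rw [hu, ih, add_assoc, add_comm 1 (n : ℤ), Nat.cast_succ]
  have hφn := norm_pos_iff.2 hφ0
  set D := ‖G‖ * (2 * lam * ‖φ‖)
  have hD : 0 ≤ D := by positivity
  have key : ∀ ε : ℝ, 0 < ε → ‖φ‖ ≤ (C * (1 + D) + D) * ε := by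
    intro ε hε
    have hsmall : ∀ k : ℤ, ∀ᶠ n : ℕ in Filter.atTop, ‖φ (k + n)‖ < ε := fun k =>
      (tendsto_coe_nat_add φ k).eventually_lt_const hε
    obtain ⟨N, hN⟩ := Filter.eventually_atTop.1 ((hsmall 0).and (hsmall 1))
    obtain ⟨n, hn, ζ, hζ, hζn⟩ := exists_primitiveRoot_approx hα (max N 1)
      (B := 1 + ε⁻¹) (by positivity)
    have hn1 : 1 ≤ n := (le_max_right _ _).trans hn
    have hzn : ‖z ^ n - 1‖ ≤ ε := by
      have h1 := norm_pow_sub_pow_le_of_norm_eq_one hz (hζ.norm'_eq_one (by omega)) n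
      rw [hζ.pow_eq_one] at h1
      have h2 : ε⁻¹ ≤ (1 + ε⁻¹) ^ n :=
        (le_add_of_nonneg_left zero_le_one).trans
          (le_self_pow₀ (by linarith [inv_pos.2 hε]) (by omega))
      have h3 : ‖z ^ n - 1‖ * ε⁻¹ ≤ 1 :=
        (mul_le_mul h1 h2 (by positivity) (by positivity)).trans hζn
      rwa [← div_eq_mul_inv, div_le_one hε] at h3
    set v : HilbertZ := ((u ^ n : unitary (HilbertZ →L[ℂ] HilbertZ)) :
      HilbertZ →L[ℂ] HilbertZ) φ with hv
    have hvn : ‖v‖ = ‖φ‖ := Unitary.norm_map _ _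
    have hTv : ‖T v‖ ≤ 2 * lam * ‖φ‖ * ε := by
      have h1 : T v = (mathieu lam u w * ((u ^ n : unitary (HilbertZ →L[ℂ] HilbertZ)) :
          HilbertZ →L[ℂ] HilbertZ) - ((u ^ n : unitary (HilbertZ →L[ℂ] HilbertZ)) :
          HilbertZ →L[ℂ] HilbertZ) * mathieu lam u w) φ := by
        rw [← hHu]
        change _ = H v - ((u ^ n : unitary (HilbertZ →L[ℂ] HilbertZ)) :
          HilbertZ →L[ℂ] HilbertZ) (H φ)
        rw [hTapp, sub_eq_zero] at hφ
        rw [hφ, map_smul, hTapp]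
      rw [h1]
      refine (ContinuousLinearMap.le_of_opNorm_le _
        (norm_mathieu_mul_pow_sub_le hlam.le hz hwu n) φ).trans ?_
      have := mul_le_mul_of_nonneg_left hzn (by positivity : 0 ≤ 2 * lam * ‖φ‖)
      linarith
    have hGT : ‖(1 - G * T) v - v‖ ≤ D * ε := by
      have h1 : (1 - G * T) v - v = -G (T v) := by
        change v - G (T v) - v = _
        abel
      rw [h1, norm_neg]
      refine (G.le_opNorm _).trans ((mul_le_mul_of_nonneg_left hTv (norm_nonneg _)).trans ?_)
      simp only [D]
      linarith
    have hcoord : ∀ k : ℤ, ‖v k‖ < ε → ‖(1 - G * T) v k‖ ≤ (1 + D) * ε := fun k hk => by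
      have h1 := (lp.norm_apply_le_norm two_ne_zero ((1 - G * T) v - v) k).trans hGT
      have h2 : (1 - G * T) v k = ((1 - G * T) v - v) k + v k := by
        rw [lp.coeFn_sub, Pi.sub_apply, sub_add_cancel]
      rw [h2]
      refine (norm_add_le _ _).trans ?_
      linarith
    obtain ⟨h0, h1⟩ := hN n ((le_max_left _ _).trans hn)
    have h2 := (hker _ (hTP v)).trans (mul_le_mul_of_nonneg_left
      (max_le (hcoord 0 (by rwa [hv, hun])) (hcoord 1 (by rwa [hv, hun]))) hC)
    have h3 : ‖v‖ ≤ ‖(1 - G * T) v - v‖ + ‖(1 - G * T) v‖ := by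
      rw [norm_sub_rev]
      simpa using norm_add_le (v - (1 - G * T) v) ((1 - G * T) v)
    rw [hvn] at h3
    linarith
  have hM : 0 ≤ C * (1 + D) + D := by positivity
  have h1 := key (‖φ‖ / (2 * (C * (1 + D) + D + 1))) (by positivity)
  rw [mul_div_assoc', le_div_iff₀ (by positivity)] at h1
  nlinarith

lemma interior_spectrum_eq_empty (hα : IsLiouvilleFrequency α) (hlam : 0 < lam)
    (hH : ∀ (ψ : HilbertZ) (n : ℤ), (H ψ) n = ψ (n + 1) + ψ (n - 1) +
        (↑(2 * lam * Real.cos (2 * Real.pi * (ω + n * α))) : ℂ) * ψ n) :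
    interior {E : ℝ | (E : ℂ) ∈ spectrum ℂ H} = ∅ := by
  rw [Set.eq_empty_iff_forall_notMem]
  intro x hx
  obtain ⟨u, w, hHu, hwu, -⟩ := exists_unitary_eq_mathieu hH
  set z : ℂ := (Circle.exp (-(2 * Real.pi * α))).val
  have hz : ‖z‖ = 1 := Circle.norm_coe _
  obtain ⟨ε, hε, hball⟩ := Metric.mem_nhds_iff.1 (mem_interior_iff_mem_nhds.1 hx)
  obtain ⟨m, hm⟩ : ∃ m, ∀ y, |y - m| ≤ 2 * (ε / 8) → |y - x| < ε ∧ ε / 4 ≤ |y| := by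
    rcases le_total 0 x with hx0 | hx0
    · refine ⟨x + ε / 2, fun y hy => ?_⟩
      rw [abs_le] at hy
      exact ⟨abs_lt.2 ⟨by linarith, by linarith⟩, le_abs.2 (Or.inl (by linarith))⟩
    · refine ⟨x - ε / 2, fun y hy => ?_⟩
      rw [abs_le] at hy
      exact ⟨abs_lt.2 ⟨by linarith, by linarith⟩, le_abs.2 (Or.inr (by linarith))⟩
  have hspec : ∀ y, |y - m| ≤ 2 * (ε / 8) → (y : ℂ) ∈ spectrum ℂ (mathieu lam u w) :=
    fun y hy => hHu ▸ hball (hm y hy).1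
  have hI : ∀ y, |y - m| ≤ 2 * (ε / 8) → |y| ≤ 2 * (1 + lam) ∧ ε / 4 ≤ |y| := fun y hy => by
    refine ⟨?_, (hm y hy).2⟩
    have := (spectrum.norm_le_norm_of_mem (hspec y hy)).trans (norm_mathieu_le hlam.le u w)
    rwa [Complex.norm_real] at this
  obtain ⟨N, B, hB, hgt⟩ := exists_disc_gt hlam (by positivity) (by positivity) hI
  obtain ⟨q, hq, ζ, hζ, hζq⟩ := exists_primitiveRoot_approx hα (max N 2)
    (B := (2 * lam + 1) * (6 * (1 + lam)) * B) (by positivity)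
  change q * ‖z - ζ‖ * _ ≤ 1 at hζq
  have hq2 : 2 ≤ q := (le_max_right _ _).trans hq
  have hη : q * (2 * lam * ‖z - ζ‖) * (6 * (1 + lam)) ^ q * B ^ q ≤ 1 := by
    refine le_trans ?_ hζq
    have h1 : 2 * lam ≤ (2 * lam + 1) ^ q :=
      (le_add_of_nonneg_right zero_le_one).trans (le_self_pow₀ (by linarith) (by omega))
    rw [mul_pow _ B, mul_pow _ (6 * (1 + lam))]
    have h2 := mul_le_mul_of_nonneg_left h1
      (by positivity : 0 ≤ q * ‖z - ζ‖ * ((6 * (1 + lam)) ^ q * B ^ q))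
    linarith
  obtain ⟨y, hy, hlt⟩ := hgt q ((le_max_left _ _).trans hq) hq2 ζ hζ _ (by positivity) hη
  exact hlt.not_ge (abs_eval_disc_le_of_mem_spectrum hlam hz hwu hq2 hζ (hspec y hy))

end Cantor

end AlmostMathieu

/-- Choi–Elliott–Yui: for Liouville `α`, every `λ > 0`, and every `ω ∈ ℝ`, the (real)
spectrum of the almost Mathieu operator
`(Hψ)(n) = ψ(n+1) + ψ(n−1) + 2λ cos(2π(ω + nα))ψ(n)` on `ℓ²(ℤ, ℂ)` is a Cantor set:
closed, without isolated points, and with empty interior. -/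
theorem choi_elliott_yui_cantor (α : ℝ) (hα : IsLiouvilleFrequency α)
    (lam ω : ℝ) (hlam : 0 < lam)
    (H : lp (fun _ : ℤ => ℂ) 2 →L[ℂ] lp (fun _ : ℤ => ℂ) 2)
    (hH : ∀ (ψ : lp (fun _ : ℤ => ℂ) 2) (n : ℤ),
      (H ψ) n = ψ (n + 1) + ψ (n - 1) +
        (↑(2 * lam * Real.cos (2 * Real.pi * (ω + n * α))) : ℂ) * ψ n) :
    IsClosed {E : ℝ | (E : ℂ) ∈ spectrum ℂ H} ∧
    (∀ E : ℝ, (E : ℂ) ∈ spectrum ℂ H →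
      E ∈ closure ({x : ℝ | (x : ℂ) ∈ spectrum ℂ H} \ {E})) ∧
    interior {E : ℝ | (E : ℂ) ∈ spectrum ℂ H} = ∅ := by
  have hreal : {x : ℝ | (x : ℂ) ∈ spectrum ℂ H} = spectrum ℝ H := spectrum.preimage_algebraMap ℂ
  refine ⟨(spectrum.isClosed H).preimage Complex.continuous_ofReal, fun E hE => ?_,
    AlmostMathieu.interior_spectrum_eq_empty hα hlam hH⟩
  rw [hreal]
  exact AlmostMathieu.mem_closure_spectrum_sdiff hα hlam hH (hreal ▸ hE)
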